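/- Let A be a commutative noetherian local ring, x = x_1,…,x_t ∈ A with 𝔞 = (x) and dim A/𝔞 = 2, and let M be an A-module with Supp_A M ⊆ V(𝔞). Then M is 𝔞-cofinite if and only if H^i(x,M) is finitely generated for all i ≤ 2. -/

import Mathlib

open CategoryTheory Limits

noncomputable section

variable {A : Type} [CommRing A]

/-- The `i`-th term of the Koszul cochain complex `Hom_A(K_•(x), M)`. -/
abbrev KoszulCochain {t : ℕ} (x : Fin t → A) (M : Type) [AddCommGroup M] [Module A M]
    (i : ℕ) : Type :=
  {s : Finset (Fin t) // s.card = i} → M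

/-- The Koszul cochain differential. -/
def koszulD {t : ℕ} (x : Fin t → A) (M : Type) [AddCommGroup M] [Module A M] (i : ℕ) :
    KoszulCochain x M i →ₗ[A] KoszulCochain x M (i + 1) :=
  LinearMap.pi fun s => ∑ j ∈ s.1.attach,
    (((-1 : A) ^ ((s.1.filter (fun k => k < j.1)).card)) * x j.1) •
      (LinearMap.proj
        (⟨s.1.erase j.1, by simp [Finset.card_erase_of_mem j.2, s.2]⟩ :
          {s : Finset (Fin t) // s.card = i}) :
        KoszulCochain x M i →ₗ[A] M)

/-- The boundaries in degree `i` of the Koszul cochain complex. -/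
def koszulBoundary {t : ℕ} (x : Fin t → A) (M : Type) [AddCommGroup M] [Module A M] :
    (i : ℕ) → Submodule A (KoszulCochain x M i)
  | 0 => ⊥
  | j + 1 => LinearMap.range (koszulD x M j)

/-- The `i`-th Koszul cohomology `H^i(x, M)` of `M` with respect to `x`. -/
abbrev KoszulCohomology {t : ℕ} (x : Fin t → A) (M : Type) [AddCommGroup M] [Module A M]
    (i : ℕ) : Type :=
  LinearMap.ker (koszulD x M i) ⧸
    (koszulBoundary x M i).comap (LinearMap.ker (koszulD x M i)).subtype

/-- `Ext_A^i(A/𝔞, M)` as an `A`-module. -/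
abbrev extQuot (𝔞 : Ideal A) (M : Type) [AddCommGroup M] [Module A M] (i : ℕ) : Type :=
  ↥(((_root_.Ext A (ModuleCat A) i).obj
    (Opposite.op (ModuleCat.of A (A ⧸ 𝔞)))).obj (ModuleCat.of A M))

/-- `M` is an `𝔞`-cofinite `A`-module: `Supp M ⊆ V(𝔞)` and all `Ext_A^i(A/𝔞, M)`
are finitely generated. -/
def IsCofinite (𝔞 : Ideal A) (M : Type) [AddCommGroup M] [Module A M] : Prop :=
  Module.support A M ⊆ PrimeSpectrum.zeroLocus (𝔞 : Set A) ∧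
    ∀ i : ℕ, Module.Finite A (extQuot 𝔞 M i)



section

/-- A cochain complex of finite free modules, given by matrices. -/
structure MC (R : Type) [CommRing R] where
  ι : ℕ → Type
  fin : ∀ n, Fintype (ι n)
  D : ∀ n, ι (n + 1) → ι n → R
  dd : ∀ n k i, ∑ j, D (n + 1) k j * D n j i = 0

attribute [instance] MC.fin

namespace MC

variable {R : Type} [CommRing R] (P : MC R)

/-- The differential with coefficients in `M`. -/
def d (n : ℕ) (M : Type) [AddCommGroup M] [Module R M] :
    (P.ι n → M) →ₗ[R] (P.ι (n + 1) → M) :=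
  LinearMap.pi fun j => ∑ i, P.D n j i • LinearMap.proj i

variable {M N L : Type} [AddCommGroup M] [Module R M] [AddCommGroup N] [Module R N]
  [AddCommGroup L] [Module R L]

lemma d_apply (n : ℕ) (f : P.ι n → M) (j : P.ι (n + 1)) :
    P.d n M f j = ∑ i, P.D n j i • f i := by
  simp [d]

lemma d_d (n : ℕ) (f : P.ι n → M) : P.d (n + 1) M (P.d n M f) = 0 := by
  ext k
  simp only [d_apply, Finset.smul_sum, smul_smul, Pi.zero_apply]
  rw [Finset.sum_comm]
  simp only [← Finset.sum_smul, P.dd, zero_smul, Finset.sum_const_zero]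

lemma d_comp (n : ℕ) (g : M →ₗ[R] N) (f : P.ι n → M) :
    P.d n N (fun i => g (f i)) = fun j => g (P.d n M f j) := by
  ext k
  simp [d_apply]

/-- Cohomology at position `n + 1`. -/
def H (n : ℕ) (M : Type) [AddCommGroup M] [Module R M] : Type :=
  LinearMap.ker (P.d (n + 1) M) ⧸
    (LinearMap.range (P.d n M)).comap (LinearMap.ker (P.d (n + 1) M)).subtype

instance (n : ℕ) : AddCommGroup (P.H n M) := by unfold H; infer_instance
instance (n : ℕ) : Module R (P.H n M) := by unfold H; infer_instance

/-- The class map. -/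
def cls (n : ℕ) (M : Type) [AddCommGroup M] [Module R M] :
    LinearMap.ker (P.d (n + 1) M) →ₗ[R] P.H n M :=
  Submodule.mkQ _

lemma cls_surj (n : ℕ) : Function.Surjective (P.cls n M) := Submodule.mkQ_surjective _

lemma cls_eq_zero (n : ℕ) (z : LinearMap.ker (P.d (n + 1) M)) :
    P.cls n M z = 0 ↔ ∃ w, P.d n M w = z.1 := by
  have : P.cls n M z = 0 ↔ z ∈
    (LinearMap.range (P.d n M)).comap (LinearMap.ker (P.d (n + 1) M)).subtype :=
    Submodule.Quotient.mk_eq_zero _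
  rw [this]
  simp

/-- map on cocycles -/
def mapZ (n : ℕ) (g : M →ₗ[R] N) :
    LinearMap.ker (P.d n M) →ₗ[R] LinearMap.ker (P.d n N) :=
  (g.compLeft (P.ι n)).restrict (fun z hz => by
    have := P.d_comp n g z
    rw [LinearMap.mem_ker] at hz ⊢
    refine this.trans ?_
    rw [hz]; ext; simp)

@[simp] lemma mapZ_coe (n : ℕ) (g : M →ₗ[R] N) (z : LinearMap.ker (P.d n M)) :
    (P.mapZ n g z : P.ι n → N) = fun i => g (z.1 i) := rfl

/-- map on cohomology -/
def map (n : ℕ) (g : M →ₗ[R] N) : P.H n M →ₗ[R] P.H n N :=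
  Submodule.mapQ _ _ (P.mapZ (n + 1) g) (by
    rintro z ⟨w, hw⟩
    refine ⟨fun i => g (w i), ?_⟩
    rw [d_comp]
    ext i
    simp [hw])

lemma map_cls (n : ℕ) (g : M →ₗ[R] N) (z : LinearMap.ker (P.d (n + 1) M)) :
    P.map n g (P.cls n M z) = P.cls n N (P.mapZ (n + 1) g z) := rfl

lemma map_comp (n : ℕ) (g : M →ₗ[R] N) (h : N →ₗ[R] L) (e : P.H n M) :
    P.map n h (P.map n g e) = P.map n (h ∘ₗ g) e := by
  obtain ⟨z, rfl⟩ := P.cls_surj n e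
  rfl

lemma map_smul_id (n : ℕ) (r : R) (e : P.H n M) :
    P.map n (r • (LinearMap.id : M →ₗ[R] M)) e = r • e := by
  obtain ⟨z, rfl⟩ := P.cls_surj n e
  rw [map_cls, ← map_smul]
  rfl

/-- finite generation of cohomology -/
def FG (n : ℕ) (M : Type) [AddCommGroup M] [Module R M] : Prop := Module.Finite R (P.H n M)

end MC

/-- auxiliary finiteness lemma -/
lemma fg_range_of {R : Type} [CommRing R] [IsNoetherianRing R] {T X Y : Type}
    [AddCommGroup T] [Module R T] [AddCommGroup X] [Module R X] [AddCommGroup Y] [Module R Y]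
    (α : T →ₗ[R] X) (β : T →ₗ[R] Y) [Module.Finite R Y]
    (h : ((LinearMap.ker β).map α).FG) : (LinearMap.range α).FG := by
  rw [LinearMap.range_eq_map]
  apply Submodule.fg_of_fg_map_of_fg_inf_ker (f := (Submodule.mkQ ((LinearMap.ker β).map α)))
  · rw [← Submodule.map_comp]
    have : LinearMap.ker β ≤ LinearMap.ker (Submodule.mkQ ((LinearMap.ker β).map α) ∘ₗ α) := by
      intro t ht
      simp only [LinearMap.mem_ker, LinearMap.comp_apply, Submodule.mkQ_apply,
        Submodule.Quotient.mk_eq_zero]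
      exact ⟨t, ht, rfl⟩
    have e := (LinearMap.ker β).range_liftQ (Submodule.mkQ ((LinearMap.ker β).map α) ∘ₗ α) this
    have e2 := LinearMap.quotKerEquivRange β
    have : Module.Finite R (T ⧸ LinearMap.ker β) := Module.Finite.equiv e2.symm
    rw [← LinearMap.range_eq_map, ← e]
    exact Module.Finite.iff_fg.mp (Module.Finite.range _)
  · rw [Submodule.ker_mkQ]
    refine Submodule.FG.of_le h ?_
    exact inf_le_right

end



set_option linter.unusedSectionVars false

section

namespace MC

variable {R : Type} [CommRing R] [IsNoetherianRing R] (P : MC R)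
variable {M M' M'' : Type} [AddCommGroup M] [Module R M] [AddCommGroup M'] [Module R M']
  [AddCommGroup M''] [Module R M'']

lemma FG.of_injective {n : ℕ} {X : Type} [AddCommGroup X] [Module R X] [Module.Finite R X]
    (f : P.H n M →ₗ[R] X) (hf : Function.Injective f) : P.FG n M :=
  Module.Finite.of_injective f hf

lemma FG.of_ker {n m : ℕ} (f : P.H n M →ₗ[R] P.H m M') (hk : (LinearMap.ker f).FG)
    (h : P.FG m M') : P.FG n M := by
  have : Module.Finite R (P.H m M') := h
  have : Module.Finite R (LinearMap.ker f) := Module.Finite.iff_fg.mpr hk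
  unfold FG
  rw [Module.finite_def]
  apply Submodule.fg_of_fg_map_of_fg_inf_ker f
  · rw [← LinearMap.range_eq_map]
    exact Module.Finite.iff_fg.mp inferInstance
  · simpa using hk

lemma fg_of_finite (n : ℕ) [Module.Finite R M] : P.FG n M := by
  have : Module.Finite R (LinearMap.ker (P.d (n + 1) M)) := inferInstance
  exact Module.Finite.of_surjective (P.cls n M) (P.cls_surj n)

section exact

variable {f : M' →ₗ[R] M} {g : M →ₗ[R] M''}

lemma exact_mid (hf : Function.Injective f) (hfg : Function.Exact f g)
    (hg : Function.Surjective g) (n : ℕ) (e : P.H n M) (he : P.map n g e = 0) :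
    ∃ e', P.map n f e' = e := by
  obtain ⟨⟨z, hz⟩, rfl⟩ := P.cls_surj n e
  rw [map_cls, cls_eq_zero] at he
  obtain ⟨w, hw⟩ := he
  choose s hs using hg
  set v : P.ι n → M := fun i => s (w i)
  have hv : (fun i => g (v i)) = w := funext fun i => hs _
  have h1 : ∀ i, ∃ y, f y = (z - P.d n M v) i := by
    intro i
    refine (hfg _).mp ?_
    have := congrFun (P.d_comp n g v) i
    rw [hv] at this
    have h2 := congrFun hw i
    simp only [mapZ_coe] at h2
    simp [← h2, this]
  choose z' hz' using h1
  have hz'2 : (fun i => f (z' i)) = z - P.d n M v := funext hz'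
  refine ⟨P.cls n M' ⟨z', ?_⟩, ?_⟩
  · rw [LinearMap.mem_ker]
    ext j
    apply hf
    rw [← congrFun (P.d_comp (n + 1) f z') j, hz'2, map_sub, d_d, LinearMap.mem_ker.mp hz]
    simp
  · rw [map_cls, ← sub_eq_zero, ← map_sub, cls_eq_zero]
    refine ⟨-v, ?_⟩
    simp only [AddSubgroupClass.coe_sub, mapZ_coe, hz'2]
    simp

/-- pairs of a cochain and a cocycle -/
def pairs (f : M' →ₗ[R] M) (n : ℕ) : Submodule R ((P.ι n → M) × (P.ι (n + 1) → M')) :=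
  LinearMap.eqLocus (P.d n M ∘ₗ LinearMap.fst R _ _)
    (f.compLeft (P.ι (n + 1)) ∘ₗ LinearMap.snd R _ _)

lemma mem_pairs {n : ℕ} (p : (P.ι n → M) × (P.ι (n + 1) → M')) :
    p ∈ P.pairs f n ↔ P.d n M p.1 = fun i => f (p.2 i) := Iff.rfl

lemma pairs_snd (hf : Function.Injective f) {n : ℕ} (p : P.pairs f n) :
    p.1.2 ∈ LinearMap.ker (P.d (n + 1) M') := by
  have := (P.mem_pairs (f := f) p.1).mp p.2
  rw [LinearMap.mem_ker]
  ext j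
  apply hf
  rw [← congrFun (P.d_comp (n + 1) f p.1.2) j, ← this, d_d]
  simp

lemma pairs_fst (hfg : Function.Exact f g) {n : ℕ} (p : P.pairs f n) :
    (fun i => g (p.1.1 i)) ∈ LinearMap.ker (P.d n M'') := by
  have := (P.mem_pairs (f := f) p.1).mp p.2
  rw [LinearMap.mem_ker, d_comp, this]
  ext i
  exact hfg.apply_apply_eq_zero _

/-- class of second component -/
def pairSnd (hf : Function.Injective f) (n : ℕ) : P.pairs f n →ₗ[R] P.H n M' :=
  P.cls n M' ∘ₗ ((LinearMap.snd R _ _) ∘ₗ (P.pairs f n).subtype).codRestrict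
    (LinearMap.ker (P.d (n + 1) M')) (fun p => P.pairs_snd hf p)

/-- class of first component -/
def pairFst (hfg : Function.Exact f g) (n : ℕ) : P.pairs f (n + 1) →ₗ[R] P.H n M'' :=
  P.cls n M'' ∘ₗ (g.compLeft (P.ι (n + 1)) ∘ₗ (LinearMap.fst R _ _) ∘ₗ
    (P.pairs f (n + 1)).subtype).codRestrict
    (LinearMap.ker (P.d (n + 1) M'')) (fun p => P.pairs_fst hfg p)

lemma ker_map_g_fg (hf : Function.Injective f) (hfg : Function.Exact f g)
    (hg : Function.Surjective g) (n : ℕ) (h : P.FG n M') : (LinearMap.ker (P.map n g)).FG := by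
  have : Module.Finite R (P.H n M') := h
  have h2 : (LinearMap.range (P.map n f)).FG := Module.Finite.iff_fg.mp inferInstance
  refine Submodule.FG.of_le h2 ?_
  intro e he
  exact P.exact_mid hf hfg hg n e he

lemma ker_map_f_fg (hf : Function.Injective f) (hfg : Function.Exact f g)
    (hg : Function.Surjective g) (n : ℕ) (h : P.FG n M'') :
    (LinearMap.ker (P.map (n + 1) f)).FG := by
  have : Module.Finite R (P.H n M'') := h
  have h2 : (LinearMap.range (P.pairSnd hf (n + 1))).FG := by
    apply fg_range_of _ (P.pairFst hfg n)
    convert Submodule.fg_bot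
    rw [eq_bot_iff]
    rintro _ ⟨p, hp, rfl⟩
    obtain ⟨v'', hv⟩ := (P.cls_eq_zero n _).mp (LinearMap.mem_ker.mp hp)
    choose s hs using hg
    set v : P.ι n → M := fun i => s (v'' i)
    have hv2 : (fun i => g (v i)) = v'' := funext fun i => hs _
    have h1 : ∀ i, ∃ y, f y = (p.1.1 - P.d n M v) i := by
      intro i
      refine (hfg _).mp ?_
      have := congrFun (P.d_comp n g v) i
      rw [hv2] at this
      have h2 : P.d n M'' v'' i = g (p.1.1 i) := congrFun hv i
      simp [← h2, this]
    choose u hu using h1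
    have hu2 : (fun i => f (u i)) = p.1.1 - P.d n M v := funext hu
    refine (P.cls_eq_zero (n + 1) _).mpr ⟨u, ?_⟩
    ext j
    apply hf
    rw [← congrFun (P.d_comp (n + 1) f u) j, hu2, map_sub, d_d, sub_zero]
    exact congrFun ((P.mem_pairs (f := f) p.1).mp p.2) j
  refine Submodule.FG.of_le h2 ?_
  intro e he
  obtain ⟨⟨z, hz⟩, rfl⟩ := P.cls_surj _ e
  rw [LinearMap.mem_ker, map_cls, cls_eq_zero] at he
  obtain ⟨w, hw⟩ := he
  exact ⟨⟨(w, z), hw⟩, rfl⟩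

lemma ker_map_f_zero (hf : Function.Injective f) [IsEmpty (P.ι 0)] :
    LinearMap.ker (P.map 0 f) = ⊥ := by
  rw [eq_bot_iff]
  intro e he
  obtain ⟨⟨z, hz⟩, rfl⟩ := P.cls_surj _ e
  rw [LinearMap.mem_ker, map_cls, cls_eq_zero] at he
  obtain ⟨w, hw⟩ := he
  refine (P.cls_eq_zero 0 _).mpr ⟨0, ?_⟩
  rw [map_zero]
  ext j
  apply hf
  have := congrFun hw j
  rw [Subsingleton.elim w 0] at this
  simpa using this

lemma fg_mid (hf : Function.Injective f) (hfg : Function.Exact f g)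
    (hg : Function.Surjective g) {n : ℕ} (h : P.FG n M') (h' : P.FG n M'') : P.FG n M :=
  FG.of_ker P (P.map n g) (P.ker_map_g_fg hf hfg hg n h) h'

lemma fg_left (hf : Function.Injective f) (hfg : Function.Exact f g)
    (hg : Function.Surjective g) {n : ℕ} (h : P.FG n M'') (h' : P.FG (n + 1) M) :
    P.FG (n + 1) M' :=
  FG.of_ker P (P.map (n + 1) f) (P.ker_map_f_fg hf hfg hg n h) h'

lemma fg_left_zero (hf : Function.Injective f) [IsEmpty (P.ι 0)] (h' : P.FG 0 M) :
    P.FG 0 M' :=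
  FG.of_ker P (P.map 0 f) (by rw [P.ker_map_f_zero hf]; exact Submodule.fg_bot) h'

lemma fg_right (hf : Function.Injective f) (hfg : Function.Exact f g)
    (hg : Function.Surjective g) {n : ℕ} (h : P.FG n M) (h' : P.FG (n + 1) M') :
    P.FG n M'' := by
  have : Module.Finite R (P.H n M) := h
  have : Module.Finite R (P.H (n + 1) M') := h'
  have h1 : (LinearMap.range (P.map n g)).FG := Module.Finite.iff_fg.mp inferInstance
  have h2 : (LinearMap.range (P.pairFst hfg n)).FG := by
    apply fg_range_of _ (P.pairSnd hf (n + 1))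
    refine Submodule.FG.of_le h1 ?_
    rintro _ ⟨p, hp, rfl⟩
    obtain ⟨u, hu⟩ := (P.cls_eq_zero (n + 1) _).mp (LinearMap.mem_ker.mp hp)
    have hu' : P.d (n + 1) M' u = p.1.2 := hu
    have hp2 := (P.mem_pairs (f := f) p.1).mp p.2
    have hz : P.d (n + 1) M (p.1.1 - fun i => f (u i)) = 0 := by
      rw [map_sub, hp2, d_comp, hu', sub_self]
    refine ⟨P.cls n M ⟨_, hz⟩, ?_⟩
    rw [map_cls]
    refine congrArg (P.cls n M'') (Subtype.ext ?_)
    ext i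
    change g (p.1.1 i - f (u i)) = g (p.1.1 i)
    rw [map_sub, hfg.apply_apply_eq_zero, sub_zero]
  have h3 : LinearMap.range (P.pairFst hfg n) = ⊤ := by
    rw [eq_top_iff]
    rintro e -
    obtain ⟨⟨z, hz⟩, rfl⟩ := P.cls_surj _ e
    choose s hs using hg
    set w : P.ι (n + 1) → M := fun i => s (z i)
    have hw : (fun i => g (w i)) = z := funext fun i => hs _
    have h1 : ∀ i, ∃ y, f y = (P.d (n + 1) M w) i := by
      intro i
      refine (hfg _).mp ?_
      have := congrFun (P.d_comp (n + 1) g w) i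
      rw [hw, LinearMap.mem_ker.mp hz] at this
      simpa using this.symm
    choose u hu using h1
    refine ⟨⟨(w, u), ?_⟩, ?_⟩
    · exact (P.mem_pairs (f := f) _).mpr (funext fun i => (hu i).symm)
    · exact congrArg (P.cls n M'') (Subtype.ext hw)
  rw [h3] at h2
  exact ⟨h2⟩

end exact

lemma fg_congr {n : ℕ} (e : M ≃ₗ[R] M') (h : P.FG n M) : P.FG n M' := by
  have : Module.Finite R (P.H n M) := h
  refine Module.Finite.of_surjective (P.map n e.toLinearMap) ?_
  intro y
  refine ⟨P.map n e.symm.toLinearMap y, ?_⟩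
  rw [map_comp]
  obtain ⟨⟨z, hz⟩, rfl⟩ := P.cls_surj _ y
  rw [map_cls]
  refine congrArg (P.cls n M') (Subtype.ext ?_)
  ext i
  simp

/-- cohomology of a finite power -/
lemma fg_pi {n : ℕ} {κ : Type} [Finite κ] (h : P.FG n M) : P.FG n (κ → M) := by
  have : Module.Finite R (P.H n M) := h
  refine FG.of_injective P (LinearMap.pi fun k : κ => P.map n (LinearMap.proj k)) ?_
  rw [← LinearMap.ker_eq_bot, eq_bot_iff]
  intro e he
  obtain ⟨⟨z, hz⟩, rfl⟩ := P.cls_surj _ e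
  have h1 : ∀ k : κ, ∃ w, P.d n M w = fun i => z i k := by
    intro k
    have := congrFun (LinearMap.mem_ker.mp he) k
    exact (P.cls_eq_zero n _).mp this
  choose w hw using h1
  refine (P.cls_eq_zero n _).mpr ⟨fun i k => w k i, ?_⟩
  ext j k
  have h2 := congrFun (P.d_comp n (LinearMap.proj k : (κ → M) →ₗ[R] M) (fun i k => w k i)) j
  have h3 := congrFun (hw k) j
  exact h2.symm.trans h3

end MC

end



set_option linter.unusedSectionVars false
section

lemma fg_of_ker_comp {R : Type} [CommRing R] [IsNoetherianRing R] {X Y Z : Type}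
    [AddCommGroup X] [Module R X] [AddCommGroup Y] [Module R Y] [AddCommGroup Z] [Module R Z]
    (f : X →ₗ[R] Y) (g : Y →ₗ[R] Z) (hf : (LinearMap.ker f).FG) (hg : (LinearMap.ker g).FG) :
    (LinearMap.ker (g ∘ₗ f)).FG := by
  apply Submodule.fg_of_fg_map_of_fg_inf_ker f
  · refine Submodule.FG.of_le hg ?_
    rintro _ ⟨x, hx, rfl⟩
    exact hx
  · exact Submodule.FG.of_le hf inf_le_right

namespace MC

variable {R : Type} [CommRing R] [IsNoetherianRing R] (P Q : MC R)
variable {M : Type} [AddCommGroup M] [Module R M]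

lemma zseq_exact (p : ℕ) : Function.Exact (LinearMap.ker (Q.d p M)).subtype
    (Q.d p M).rangeRestrict := by
  intro y
  constructor
  · intro h
    exact ⟨⟨y, congrArg Subtype.val h⟩, rfl⟩
  · rintro ⟨z, rfl⟩
    exact Subtype.ext z.2

/-- inclusion of boundaries in cycles -/
def bInc (p : ℕ) (M : Type) [AddCommGroup M] [Module R M] :
    LinearMap.range (Q.d p M) →ₗ[R] LinearMap.ker (Q.d (p + 1) M) :=
  Submodule.inclusion (by rintro _ ⟨w, rfl⟩; exact Q.d_d p w)

lemma bInc_inj (p : ℕ) : Function.Injective (Q.bInc p M) := Submodule.inclusion_injective _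

lemma bseq_exact (p : ℕ) : Function.Exact (Q.bInc p M) (Q.cls p M) := by
  intro y
  rw [cls_eq_zero]
  constructor
  · rintro ⟨w, hw⟩
    exact ⟨⟨y.1, w, hw⟩, rfl⟩
  · rintro ⟨⟨_, w, rfl⟩, rfl⟩
    exact ⟨w, rfl⟩

lemma compare_B [IsEmpty (P.ι 0)] (hQ : ∀ n, Q.FG n M) (n : ℕ)
    (hP : ∀ m < n, P.FG m M) (m : ℕ) (hm : m < n) :
    ∀ p, P.FG m (LinearMap.range (Q.d p M)) := by
  induction m with
  | zero =>
    intro p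
    exact P.fg_left_zero (f := (LinearMap.range (Q.d p M)).subtype) Subtype.val_injective
      (P.fg_pi (hP 0 hm))
  | succ m ih =>
    intro p
    have hH : Module.Finite R (Q.H p M) := hQ p
    have h1 : P.FG (m + 1) (LinearMap.ker (Q.d (p + 1) M)) :=
      P.fg_left Subtype.val_injective (Q.zseq_exact (p + 1))
        (LinearMap.surjective_rangeRestrict _) (ih (by omega) _) (P.fg_pi (hP _ hm))
    exact P.fg_left (Q.bInc_inj p) (Q.bseq_exact p) (Q.cls_surj p) (P.fg_of_finite m) h1

lemma compare_zero (hk : ∀ n (j : Q.ι 2) (i : Q.ι 1) (e : P.H n M), Q.D 1 j i • e = 0)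
    (n : ℕ) (e : P.H n (Q.ι 1 → M)) : P.map n (Q.d 1 M) e = 0 := by
  obtain ⟨⟨z, hz⟩, rfl⟩ := P.cls_surj _ e
  rw [map_cls, cls_eq_zero]
  have h1 : ∀ (j : Q.ι 2) (i : Q.ι 1), ∃ w, P.d n M w = fun k => Q.D 1 j i • z k i := by
    intro j i
    have := hk n j i (P.cls n M (P.mapZ (n + 1) (LinearMap.proj i) ⟨z, hz⟩))
    rw [← map_smul, cls_eq_zero] at this
    exact this
  choose w hw using h1
  refine ⟨fun k j => ∑ i, w j i k, ?_⟩
  ext k j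
  have h2 := congrFun (P.d_comp n (LinearMap.proj j : (Q.ι 2 → M) →ₗ[R] M)
    (fun k j => ∑ i, w j i k)) k
  have h4 : (fun k => ∑ i, w j i k) = ∑ i, w j i := by ext; simp
  refine h2.symm.trans ?_
  simp only [LinearMap.proj_apply, h4, map_sum, hw, mapZ_coe]
  simp [Q.d_apply]

lemma compare_step [IsEmpty (P.ι 0)] [IsEmpty (Q.ι 0)] (hQ : ∀ n, Q.FG n M)
    (hk : ∀ n (j : Q.ι 2) (i : Q.ι 1) (e : P.H n M), Q.D 1 j i • e = 0) (n : ℕ)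
    (hP : ∀ m < n, P.FG m M) : P.FG n (Q.ι 1 → M) := by
  have hB := P.compare_B Q hQ n hP
  have hZ1 : Module.Finite R (LinearMap.ker (Q.d 1 M)) := by
    have : Module.Finite R (Q.H 0 M) := hQ 0
    refine Module.Finite.of_injective (Q.cls 0 M) ?_
    rw [← LinearMap.ker_eq_bot, eq_bot_iff]
    intro z hz
    obtain ⟨w, hw⟩ := (Q.cls_eq_zero 0 _).mp hz
    rw [Subsingleton.elim w 0, map_zero] at hw
    exact Subtype.ext hw.symm
  have hker1 := P.ker_map_g_fg (f := (LinearMap.ker (Q.d 1 M)).subtype) Subtype.val_injective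
    (Q.zseq_exact 1) (LinearMap.surjective_rangeRestrict _) n (P.fg_of_finite n)
  have hker2 : (LinearMap.ker (P.map n (LinearMap.ker (Q.d 2 M)).subtype ∘ₗ
      P.map n (Q.bInc 1 M))).FG := by
    have hH : Module.Finite R (Q.H 1 M) := hQ 1
    cases n with
    | zero =>
      apply fg_of_ker_comp
      · rw [P.ker_map_f_zero (Q.bInc_inj 1)]; exact Submodule.fg_bot
      · rw [P.ker_map_f_zero Subtype.val_injective]; exact Submodule.fg_bot
    | succ k =>
      apply fg_of_ker_comp
      · exact P.ker_map_f_fg (Q.bInc_inj 1) (Q.bseq_exact 1) (Q.cls_surj 1) k (P.fg_of_finite k)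
      · exact P.ker_map_f_fg Subtype.val_injective (Q.zseq_exact 2)
          (LinearMap.surjective_rangeRestrict _) k (hB k (by omega) 2)
  unfold FG
  rw [Module.finite_def]
  apply Submodule.fg_of_fg_map_of_fg_inf_ker (P.map n (Q.d 1 M).rangeRestrict)
  · refine Submodule.FG.of_le hker2 ?_
    rintro _ ⟨e, -, rfl⟩
    rw [LinearMap.mem_ker, LinearMap.comp_apply, map_comp, map_comp]
    exact P.compare_zero Q hk n e
  · simpa using hker1

theorem compare [IsEmpty (P.ι 0)] [IsEmpty (Q.ι 0)] [Nonempty (Q.ι 1)] (hQ : ∀ n, Q.FG n M)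
    (hk : ∀ n (j : Q.ι 2) (i : Q.ι 1) (e : P.H n M), Q.D 1 j i • e = 0) (n : ℕ) :
    P.FG n M := by
  induction n using Nat.strong_induction_on with
  | _ n ih =>
    have h := P.compare_step Q hQ hk n ih
    have : Module.Finite R (P.H n (Q.ι 1 → M)) := h
    obtain ⟨i0⟩ := ‹Nonempty (Q.ι 1)›
    refine Module.Finite.of_surjective (P.map n (LinearMap.proj i0 : (Q.ι 1 → M) →ₗ[R] M)) ?_
    intro e
    obtain ⟨z, rfl⟩ := P.cls_surj _ e
    refine ⟨P.map n (LinearMap.pi fun _ => LinearMap.id) (P.cls n M z), ?_⟩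
    rw [map_comp]
    rfl

end MC

end



set_option linter.unusedSectionVars false
section

namespace Kos

variable {R : Type} [CommRing R] {t : ℕ} (x : Fin t → R)
variable {M : Type} [AddCommGroup M] [Module R M]

/-- sign -/
def sg (R : Type) [CommRing R] {t : ℕ} (j : Fin t) (s : Finset (Fin t)) : R :=
  (-1 : R) ^ ((s.filter (fun k => k < j)).card)

lemma sg_mul_self (j : Fin t) (s : Finset (Fin t)) : sg R j s * sg R j s = 1 := by
  unfold sg; rw [← mul_pow]; simp

lemma sg_erase_self (j : Fin t) (s : Finset (Fin t)) : sg R j (s.erase j) = sg R j s := by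
  unfold sg
  congr 2
  ext k
  simp only [Finset.mem_filter, Finset.mem_erase]
  constructor
  · tauto
  · rintro ⟨h1, h2⟩; exact ⟨⟨h2.ne, h1⟩, h2⟩

lemma sg_insert (j k : Fin t) (s : Finset (Fin t)) (hk : k ∉ s) :
    sg R j (insert k s) = (if k < j then -1 else 1) * sg R j s := by
  unfold sg
  rw [Finset.filter_insert]
  split_ifs with h
  · rw [Finset.card_insert_of_notMem (by simp [hk]), pow_succ]; ring
  · simp

lemma sg_erase (j k : Fin t) (s : Finset (Fin t)) (hk : k ∈ s) :
    sg R j (s.erase k) = (if k < j then -1 else 1) * sg R j s := by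
  conv_rhs => rw [← Finset.insert_erase hk, sg_insert j k _ (Finset.notMem_erase k s)]
  split_ifs <;> simp

/-- exterior multiplication -/
def e (j : Fin t) (f : Finset (Fin t) → M) (s : Finset (Fin t)) : M :=
  if j ∈ s then sg R j s • f (s.erase j) else 0

/-- contraction -/
def h (R : Type) [CommRing R] {M : Type} [AddCommGroup M] [Module R M]
    (j : Fin t) (f : Finset (Fin t) → M) (s : Finset (Fin t)) : M :=
  if j ∈ s then 0 else sg R j s • f (insert j s)

lemma e_e_self (j : Fin t) (f : Finset (Fin t) → M) (s) : e (R := R) j (e (R := R) j f) s = 0 := by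
  simp [e]

lemma e_e (j k : Fin t) (hjk : j ≠ k) (f : Finset (Fin t) → M) (s) :
    e (R := R) j (e (R := R) k f) s + e (R := R) k (e (R := R) j f) s = 0 := by
  unfold e
  by_cases hj : j ∈ s <;> by_cases hk : k ∈ s <;> simp [hj, hk, hjk, hjk.symm]
  rw [Finset.erase_right_comm, smul_smul, smul_smul, ← add_smul, sg_erase _ _ _ hj,
    sg_erase _ _ _ hk]
  rcases lt_or_gt_of_ne hjk with h1 | h1
  · simp only [h1, h1.not_gt, if_true, if_false]
    convert zero_smul R _ using 2
    ring
  · simp only [h1, h1.not_gt, if_true, if_false]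
    convert zero_smul R _ using 2
    ring

lemma e_h_self (j : Fin t) (f : Finset (Fin t) → M) (s) :
    e (R := R) j (h R j f) s + h R j (e (R := R) j f) s = f s := by
  unfold e h
  by_cases hj : j ∈ s
  · simp [hj, sg_erase_self, smul_smul, sg_mul_self]
  · have : sg R j (insert j s) = sg R j s := by
      conv_rhs => rw [← Finset.erase_insert hj, sg_erase_self]
    simp [hj, this, smul_smul, sg_mul_self]

lemma e_h (j k : Fin t) (hjk : j ≠ k) (f : Finset (Fin t) → M) (s) :
    e (R := R) j (h R k f) s + h R k (e (R := R) j f) s = 0 := by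
  unfold e h
  by_cases hj : j ∈ s <;> by_cases hk : k ∈ s <;> simp [hj, hk, hjk, hjk.symm]
  rw [Finset.erase_insert_of_ne hjk.symm, smul_smul, smul_smul, ← add_smul, sg_erase _ _ _ hj,
    sg_insert _ _ _ hk]
  rcases lt_or_gt_of_ne hjk with h1 | h1
  · simp only [h1, h1.not_gt, if_true, if_false]
    convert zero_smul R _ using 2
    ring
  · simp only [h1, h1.not_gt, if_true, if_false]
    convert zero_smul R _ using 2
    ring

/-- total differential -/
def T (f : Finset (Fin t) → M) (s : Finset (Fin t)) : M := ∑ j, x j • e (R := R) j f s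

lemma e_sum (j : Fin t) {κ : Type} (S : Finset κ) (c : κ → R) (f : κ → Finset (Fin t) → M) (s) :
    e (R := R) j (fun s => ∑ k ∈ S, c k • f k s) s = ∑ k ∈ S, c k • e (R := R) j (f k) s := by
  unfold e
  split_ifs
  · rw [Finset.smul_sum]
    exact Finset.sum_congr rfl fun k _ => smul_comm _ _ _
  · simp

lemma h_sum (j : Fin t) {κ : Type} (S : Finset κ) (c : κ → R) (f : κ → Finset (Fin t) → M) (s) :
    h R j (fun s => ∑ k ∈ S, c k • f k s) s = ∑ k ∈ S, c k • h R j (f k) s := by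
  unfold h
  split_ifs
  · simp
  · rw [Finset.smul_sum]
    exact Finset.sum_congr rfl fun k _ => smul_comm _ _ _

lemma T_T (f : Finset (Fin t) → M) (s) : T x (T x f) s = 0 := by
  have : T x (T x f) s = ∑ p : Fin t × Fin t,
      (x p.1 * x p.2) • e (R := R) p.1 (e (R := R) p.2 f) s := by
    rw [Fintype.sum_prod_type]
    unfold T
    refine Finset.sum_congr rfl fun j _ => ?_
    rw [e_sum, Finset.smul_sum]
    exact Finset.sum_congr rfl fun k _ => smul_smul _ _ _
  rw [this]
  refine Finset.sum_involution (fun p _ => (p.2, p.1)) ?_ ?_ (fun _ _ => Finset.mem_univ _)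
    (fun _ _ => rfl)
  · rintro ⟨j, k⟩ -
    by_cases hjk : j = k
    · subst hjk; simp [e_e_self]
    · simp only
      rw [mul_comm (x k) (x j), ← smul_add, e_e j k hjk, smul_zero]
  · rintro ⟨j, k⟩ - h0 heq
    simp only [Prod.mk.injEq] at heq
    apply h0
    simp [heq.1, e_e_self]

lemma T_h (k : Fin t) (f : Finset (Fin t) → M) (s) :
    T x (h R k f) s + h R k (T x f) s = x k • f s := by
  unfold T
  rw [h_sum, ← Finset.sum_add_distrib, Finset.sum_eq_single k]
  · rw [← smul_add, e_h_self]
  · intro j _ hj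
    rw [← smul_add, e_h j k hj, smul_zero]
  · simp

/-- index type -/
abbrev ix (t n : ℕ) : Type := {s : Finset (Fin t) // s.card + 1 = n}

/-- extension by zero -/
def ext0 {n : ℕ} (f : ix t n → M) (s : Finset (Fin t)) : M :=
  if hs : s.card + 1 = n then f ⟨s, hs⟩ else 0

/-- matrix coefficients -/
def E (s s' : Finset (Fin t)) : R := ∑ j ∈ s, if s.erase j = s' then sg R j s * x j else 0

lemma sum_E {n : ℕ} (f : ix t n → M) (s : Finset (Fin t)) :
    ∑ s' : ix t n, E x s s'.1 • f s' = T x (ext0 f) s := by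
  unfold E T e
  simp only [Finset.sum_smul, smul_ite, smul_zero]
  rw [Finset.sum_comm, ← Finset.sum_filter, Finset.filter_mem_eq_inter, Finset.univ_inter]
  refine Finset.sum_congr rfl fun j _ => ?_
  unfold ext0
  split_ifs with hc
  · rw [Finset.sum_eq_single ⟨s.erase j, hc⟩]
    · simp [smul_smul, mul_comm]
    · intro b _ hb
      rw [if_neg, zero_smul]
      intro h; exact hb (Subtype.ext h.symm)
    · simp
  · rw [Finset.sum_eq_zero]
    · simp
    · intro b _
      rw [if_neg, zero_smul]
      intro h; rw [h] at hc; exact hc b.2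

lemma ext0_T {n : ℕ} (f : ix t n → M) :
    ext0 (fun s : ix t (n + 1) => T x (ext0 f) s.1) = T x (ext0 f) := by
  ext s
  by_cases hs : s.card + 1 = n + 1
  · simp [ext0, hs]
  · simp only [ext0, hs, dite_false]
    symm
    unfold T
    refine Finset.sum_eq_zero fun j _ => ?_
    unfold e ext0
    split_ifs with h1 h2
    · rw [Finset.card_erase_of_mem h1] at h2
      have := Finset.card_pos.mpr ⟨j, h1⟩
      omega
    · simp
    · simp

/-- The Koszul matrix complex. -/
abbrev K : MC R where
  ι := ix t
  fin := fun _ => inferInstance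
  D := fun _ s s' => E x s.1 s'.1
  dd := by
    intro n k i
    have h1 := T_T x (ext0 (Pi.single i (1 : R))) k.1
    rw [← ext0_T x, ← sum_E] at h1
    rw [← h1]
    refine Finset.sum_congr rfl fun j _ => ?_
    rw [← sum_E]
    simp [Pi.single_apply]

lemma K_d {n : ℕ} (f : ix t n → M) (s : ix t (n + 1)) :
    (K x).d n M f s = T x (ext0 f) s.1 := by
  exact ((K x).d_apply n f s).trans (sum_E x f s.1)

lemma ext0_d {n : ℕ} (f : ix t n → M) : ext0 ((K x).d n M f) = T x (ext0 f) := by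
  rw [← ext0_T]; congr 1; ext s; exact K_d x f s

instance : IsEmpty ((K x).ι 0) := ⟨fun s => by have := s.2; omega⟩
/-- the index of the empty set -/
abbrev nil (t : ℕ) : ix t 1 := ⟨∅, rfl⟩

lemma eq_nil (s : ix t 1) : s = nil t :=
  Subtype.ext (Finset.card_eq_zero.mp (by have := s.2; omega))

instance : Nonempty ((K x).ι 1) := ⟨nil t⟩

lemma ext0_h {n : ℕ} (k : Fin t) (z : ix t (n + 1) → M) :
    ext0 (fun s : ix t n => h R k (ext0 z) s.1) = h R k (ext0 z) := by
  ext s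
  by_cases hs : s.card + 1 = n
  · simp [ext0, hs]
  · simp only [ext0, hs, dite_false]
    symm
    unfold h
    by_cases h1 : k ∈ s
    · simp [h1]
    · rw [if_neg h1]
      unfold ext0
      rw [dif_neg, smul_zero]
      rw [Finset.card_insert_of_notMem h1]; omega

lemma ext0_apply {n : ℕ} (f : ix t n → M) (s : ix t n) : ext0 f s.1 = f s := by
  simp [ext0, s.2]

lemma kill_gen (n : ℕ) (k : Fin t) (c : (K x).H n M) : x k • c = 0 := by
  obtain ⟨⟨z, hz⟩, rfl⟩ := (K x).cls_surj _ c
  rw [← map_smul, MC.cls_eq_zero]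
  refine ⟨fun s : ix t n => h R k (ext0 z) s.1, ?_⟩
  ext s
  rw [K_d, ext0_h]
  have h1 := T_h x k (ext0 z) s.1
  rw [← ext0_d, LinearMap.mem_ker.mp hz] at h1
  have h2 : h R k (ext0 (0 : ix t (n + 1 + 1) → M)) s.1 = 0 := by
    have : ext0 (0 : ix t (n + 1 + 1) → M) = 0 := by ext; simp [ext0]
    rw [this]; simp [h]
  have h3 : h R k (ext0 (0 : (K x).ι (n + 1 + 1) → M)) s.1 = 0 := h2
  rw [h3, add_zero, ext0_apply] at h1
  exact h1

lemma kill (n : ℕ) (a : R) (ha : a ∈ Ideal.span (Set.range x)) (c : (K x).H n M) :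
    a • c = 0 := by
  induction ha using Submodule.span_induction with
  | mem a h => obtain ⟨k, rfl⟩ := h; exact kill_gen x n k c
  | zero => simp
  | add a b _ _ h1 h2 => rw [add_smul, h1, h2, add_zero]
  | smul r a _ h1 => rw [smul_eq_mul, mul_smul, h1, smul_zero]

lemma d1_single (f : ix t 1 → M) (j : Fin t) (hj) :
    (K x).d 1 M f ⟨{j}, hj⟩ = x j • f (nil t) := by
  rw [K_d]
  unfold T
  rw [Finset.sum_eq_single j]
  · simp [e, ext0, sg]
    have : Finset.filter (fun k => k < j) {j} = ∅ := by
      ext k; simp; rintro rfl; simp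
    rw [this]; simp
  · intro b _ hb
    simp [e, hb]
  · simp

lemma d1_const (m : M) (s : ix t 2) (hm : ∀ j, x j • m = 0) :
    (K x).d 1 M (fun _ => m) s = 0 := by
  rw [K_d]
  unfold T
  refine Finset.sum_eq_zero fun j _ => ?_
  unfold e ext0
  split_ifs
  · rw [smul_comm, hm, smul_zero]
  · simp
  · simp

/-- the map from `0 :_M 𝔞` to degree zero cohomology -/
def torsToH (M : Type) [AddCommGroup M] [Module R M] :
    Submodule.torsionBySet R M (Ideal.span (Set.range x) : Set R) →ₗ[R] (K x).H 0 M :=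
  (K x).cls 0 M ∘ₗ ((LinearMap.pi fun _ => LinearMap.id : M →ₗ[R] (K x).ι 1 → M) ∘ₗ
    (Submodule.torsionBySet R M (Ideal.span (Set.range x) : Set R)).subtype).codRestrict _
    (fun m => by
      rw [LinearMap.mem_ker]
      ext s
      refine d1_const x m.1 s fun j => ?_
      exact (Submodule.mem_torsionBySet_iff _ _).mp m.2 ⟨x j, Ideal.subset_span ⟨j, rfl⟩⟩)

lemma torsToH_bij : Function.Bijective (torsToH x M) := by
  constructor
  · rw [← LinearMap.ker_eq_bot, eq_bot_iff]
    intro m hm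
    obtain ⟨w, hw⟩ := ((K x).cls_eq_zero 0 _).mp hm
    rw [Subsingleton.elim w 0, map_zero] at hw
    exact Subtype.ext (congrFun hw (nil t)).symm
  · intro c
    obtain ⟨⟨z, hz⟩, rfl⟩ := (K x).cls_surj _ c
    have hz' : ∀ j, x j • z (nil t) = 0 := by
      intro j
      have := congrFun (LinearMap.mem_ker.mp hz) ⟨{j}, by simp⟩
      exact (d1_single x z j _).symm.trans this
    refine ⟨⟨z (nil t), ?_⟩, ?_⟩
    · rw [Submodule.mem_torsionBySet_iff]
      rintro ⟨a, ha⟩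
      change a • z (nil t) = 0
      induction ha using Submodule.span_induction with
      | mem a h => obtain ⟨k, rfl⟩ := h; exact hz' k
      | zero => simp
      | add a b _ _ h1 h2 => rw [add_smul, h1, h2, add_zero]
      | smul r a _ h1 => rw [smul_eq_mul, mul_smul, h1, smul_zero]
    · refine congrArg ((K x).cls 0 M) (Subtype.ext ?_)
      ext i
      rw [eq_nil i]
      rfl

lemma fg_zero_iff : (K x).FG 0 M ↔
    (Submodule.torsionBySet R M (Ideal.span (Set.range x) : Set R)).FG := by
  rw [← Module.Finite.iff_fg]
  exact (Module.Finite.equiv_iff (LinearEquiv.ofBijective _ (torsToH_bij x))).symm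

/-- reindexing -/
def reidx (t n : ℕ) : {s : Finset (Fin t) // s.card = n} ≃ ix t (n + 1) :=
  Equiv.subtypeEquivRight fun s => by omega

lemma koszulD_reidx (n : ℕ) (f : ix t (n + 1) → M) (s : {s : Finset (Fin t) // s.card = n + 1}) :
    koszulD x M n (fun s => f (reidx t n s)) s = (K x).d (n + 1) M f (reidx t (n + 1) s) := by
  rw [K_d]
  unfold koszulD T e
  simp only [LinearMap.pi_apply, LinearMap.sum_apply, LinearMap.smul_apply, LinearMap.proj_apply,
    smul_ite, smul_zero]
  rw [← Finset.sum_filter, Finset.filter_mem_eq_inter, Finset.univ_inter]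
  rw [← Finset.sum_attach (reidx t (n + 1) s).1]
  refine Finset.sum_congr rfl fun j _ => ?_
  have h1 : ((reidx t (n + 1) s).1.erase j.1).card + 1 = n + 1 := by
    exact (Finset.card_erase_add_one j.2).trans s.2
  rw [ext0, dif_pos h1, smul_smul, mul_comm]
  rfl

lemma koszul_finite_iff (n : ℕ) :
    Module.Finite R (KoszulCohomology x M n) ↔ (K x).FG n M := by
  let ε : (ix t (n + 1) → M) ≃ₗ[R] KoszulCochain x M n := LinearEquiv.funCongrLeft R M (reidx t n)
  have hε : ∀ f s, ε f s = f (reidx t n s) := fun f s => rfl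
  have hker : ∀ f, ε f ∈ LinearMap.ker (koszulD x M n) ↔
      f ∈ LinearMap.ker ((K x).d (n + 1) M) := by
    intro f
    rw [LinearMap.mem_ker, LinearMap.mem_ker]
    constructor
    · intro h; ext s
      obtain ⟨s, rfl⟩ := (reidx t (n + 1)).surjective s
      rw [← koszulD_reidx]; exact congrFun h s
    · intro h; ext s
      exact (koszulD_reidx x n f s).trans (congrFun h _)
  have hB : ∀ f, ε f ∈ koszulBoundary x M n ↔ f ∈ LinearMap.range ((K x).d n M) := by
    intro f
    cases n with
    | zero =>
      have h1 : koszulBoundary x M 0 = ⊥ := rfl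
      rw [h1, Submodule.mem_bot, LinearEquiv.map_eq_zero_iff]
      constructor
      · rintro rfl; exact ⟨0, map_zero _⟩
      · rintro ⟨w, rfl⟩; rw [Subsingleton.elim w 0, map_zero]
    | succ n =>
      have h1 : koszulBoundary x M (n + 1) = LinearMap.range (koszulD x M n) := rfl
      rw [h1]
      constructor
      · rintro ⟨w, hw⟩
        refine ⟨fun s => w ((reidx t n).symm s), ?_⟩
        ext s
        obtain ⟨s, rfl⟩ := (reidx t (n + 1)).surjective s
        rw [← koszulD_reidx]
        refine Eq.trans ?_ (congrFun hw s)
        simp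
      · rintro ⟨w, rfl⟩
        refine ⟨fun s => w (reidx t n s), ?_⟩
        ext s
        exact koszulD_reidx x n w s
  have hmap : Submodule.map (ε : (ix t (n + 1) → M) →ₗ[R] KoszulCochain x M n)
      (LinearMap.ker ((K x).d (n + 1) M)) = LinearMap.ker (koszulD x M n) := by
    ext z
    constructor
    · rintro ⟨w, hw, rfl⟩; exact (hker w).mpr hw
    · intro hz
      obtain ⟨w, rfl⟩ := ε.surjective z
      exact ⟨w, (hker w).mp hz, rfl⟩
  refine (Module.Finite.equiv_iff ?_).symm
  refine Submodule.Quotient.equiv _ _ (ε.ofSubmodules _ _ hmap) ?_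
  ext z
  constructor
  · rintro ⟨w, hw, rfl⟩; exact (hB w).mpr hw
  · intro hz
    refine ⟨(ε.ofSubmodules _ _ hmap).symm z, ?_, LinearEquiv.apply_symm_apply _ _⟩
    refine (hB _).mp ?_
    have h5 : ε (ε.symm z.1) = z.1 := ε.apply_symm_apply _
    have h6 : ε (ε.symm z.1) ∈ koszulBoundary x M n := by rw [h5]; exact hz
    exact h6

end Kos

end



set_option linter.unusedSectionVars false
section

open TensorProduct

namespace MC

variable {R : Type} [CommRing R] (P : MC R) (C : Type) [CommRing C] [Algebra R C]
variable (M : Type) [AddCommGroup M] [Module R M]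

/-- base change of a matrix complex -/
abbrev bc : MC C where
  ι := P.ι
  fin := P.fin
  D := fun n j i => algebraMap R C (P.D n j i)
  dd := by
    intro n k i
    simp only [← map_mul, ← map_sum, P.dd, map_zero]

/-- commuting tensor and finite powers -/
def tau (n : ℕ) : C ⊗[R] (P.ι n → M) ≃ₗ[C] (P.ι n → C ⊗[R] M) := by
  classical
  exact TensorProduct.piRight R C C (fun _ : P.ι n => M)

lemma tau_tmul (n : ℕ) (c : C) (f : P.ι n → M) : P.tau C M n (c ⊗ₜ f) = fun i => c ⊗ₜ f i := by
  unfold tau; simp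

/-- base change of a linear map -/
abbrev lt {X Y : Type} [AddCommGroup X] [Module R X] [AddCommGroup Y] [Module R Y]
    (f : X →ₗ[R] Y) : C ⊗[R] X →ₗ[C] C ⊗[R] Y := AlgebraTensorModule.lTensor C C f

lemma tau_d (n : ℕ) (w : C ⊗[R] (P.ι n → M)) :
    P.tau C M (n + 1) (lt C (P.d n M) w) = (P.bc C).d n (C ⊗[R] M) (P.tau C M n w) := by
  induction w with
  | zero => simp
  | add a b h1 h2 => rw [map_add, map_add, map_add, h1, h2, map_add]
  | tmul c f =>
    rw [tau_tmul]
    simp only [AlgebraTensorModule.lTensor_tmul, tau_tmul]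
    ext j
    rw [d_apply]
    refine Eq.trans ?_ ((P.bc C).d_apply n (fun i => c ⊗ₜ[R] f i) j).symm
    simp only [bc, tmul_sum, tmul_smul]
    refine Finset.sum_congr rfl fun i _ => ?_
    exact (algebraMap_smul C _ _).symm

/-- cycles commute with flat base change -/
def psi (n : ℕ) : C ⊗[R] LinearMap.ker (P.d n M) →ₗ[C]
    LinearMap.ker ((P.bc C).d n (C ⊗[R] M)) :=
  ((P.tau C M n).toLinearMap ∘ₗ lt C (LinearMap.ker (P.d n M)).subtype).codRestrict _ (by
    intro u
    rw [LinearMap.mem_ker, LinearMap.comp_apply]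
    refine (P.tau_d C M n _).symm.trans ?_
    have : lt C (P.d n M) (lt C (LinearMap.ker (P.d n M)).subtype u) = 0 := by
      rw [← LinearMap.comp_apply, ← AlgebraTensorModule.lTensor_comp]
      have : P.d n M ∘ₗ (LinearMap.ker (P.d n M)).subtype = 0 := by ext z; simp
      rw [this]; simp
    rw [this, map_zero])

lemma psi_coe (n : ℕ) (u) : (P.psi C M n u).1 =
    P.tau C M n (lt C (LinearMap.ker (P.d n M)).subtype u) := rfl

lemma psi_bij [Module.Flat R C] (n : ℕ) : Function.Bijective (P.psi C M n) := by
  constructor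
  · intro u v h
    have h1 := congrArg Subtype.val h
    rw [psi_coe, psi_coe] at h1
    have h2 := (P.tau C M n).injective h1
    exact Module.Flat.lTensor_preserves_injective_linearMap (M := C)
      (LinearMap.ker (P.d n M)).subtype Subtype.val_injective h2
  · rintro ⟨w, hw⟩
    obtain ⟨v, rfl⟩ := (P.tau C M n).surjective w
    have h1 : lt C (P.d n M) v = 0 := by
      apply (P.tau C M (n + 1)).injective
      rw [tau_d, map_zero]; exact hw
    have h2 := Module.Flat.lTensor_exact C (f := (LinearMap.ker (P.d n M)).subtype)
      (g := P.d n M) (LinearMap.exact_subtype_ker_map _)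
    obtain ⟨u, hu⟩ := (h2 v).mp h1
    exact ⟨u, Subtype.ext (congrArg (P.tau C M n) hu)⟩

/-- cohomology commutes with flat base change -/
def bcEquiv [Module.Flat R C] (n : ℕ) :
    C ⊗[R] P.H n M ≃ₗ[C] (P.bc C).H n (C ⊗[R] M) := by
  let Φ : C ⊗[R] LinearMap.ker (P.d (n + 1) M) →ₗ[C] (P.bc C).H n (C ⊗[R] M) :=
    (P.bc C).cls n (C ⊗[R] M) ∘ₗ P.psi C M (n + 1)
  let Θ : C ⊗[R] LinearMap.ker (P.d (n + 1) M) →ₗ[C] C ⊗[R] P.H n M := lt C (P.cls n M)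
  have hΦ : Function.Surjective Φ :=
    ((P.bc C).cls_surj n).comp (P.psi_bij C M (n + 1)).2
  have hΘ : Function.Surjective Θ := LinearMap.lTensor_surjective C (P.cls_surj n)
  have hk : LinearMap.ker Θ = LinearMap.ker Φ := by
    let b : (P.ι n → M) →ₗ[R] LinearMap.ker (P.d (n + 1) M) :=
      (P.d n M).codRestrict _ (fun w => P.d_d n w)
    have hb : Function.Exact b (P.cls n M) := by
      intro z
      rw [cls_eq_zero]
      constructor
      · rintro ⟨w, hw⟩; exact ⟨w, Subtype.ext hw⟩
      · rintro ⟨w, rfl⟩; exact ⟨w, rfl⟩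
    have hb2 := lTensor_exact C hb (P.cls_surj n)
    have hpsi : ∀ v, (P.psi C M (n + 1) (lt C b v)).1 =
        (P.bc C).d n (C ⊗[R] M) (P.tau C M n v) := by
      intro v
      rw [psi_coe, ← tau_d, ← LinearMap.comp_apply, ← AlgebraTensorModule.lTensor_comp]
      rfl
    ext u
    rw [LinearMap.mem_ker, LinearMap.mem_ker]
    refine (hb2 u).trans ?_
    change _ ↔ (P.bc C).cls n (C ⊗[R] M) (P.psi C M (n + 1) u) = 0
    rw [cls_eq_zero]
    constructor
    · rintro ⟨v, rfl⟩
      exact ⟨_, (hpsi v).symm⟩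
    · rintro ⟨w, hw⟩
      obtain ⟨v, rfl⟩ := (P.tau C M n).surjective w
      refine ⟨v, (P.psi_bij C M (n + 1)).1 (Subtype.ext ?_)⟩
      exact (hpsi v).trans hw
  exact (Θ.quotKerEquivOfSurjective hΘ).symm ≪≫ₗ Submodule.quotEquivOfEq _ _ hk ≪≫ₗ
    Φ.quotKerEquivOfSurjective hΦ

end MC

namespace Kos

variable {R : Type} [CommRing R] {t : ℕ} (x : Fin t → R)
variable (C : Type) [CommRing C] [Algebra R C] {M : Type} [AddCommGroup M] [Module R M]

/-- image of a sequence -/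
abbrev mp (x : Fin t → R) : Fin t → C := fun i => algebraMap R C (x i)

lemma span_mp : Ideal.span (Set.range (mp C x)) =
    (Ideal.span (Set.range x)).map (algebraMap R C) := by
  rw [Ideal.map_span, ← Set.range_comp]; rfl

lemma bc_K : (K x).bc C = K (mp C x) := by
  unfold MC.bc K
  congr 1
  funext n s s'
  simp only [E, map_sum]
  refine Finset.sum_congr rfl fun j _ => ?_
  split_ifs <;> simp [sg]

/-- flat base change of Koszul cohomology -/
def bcK [Module.Flat R C] (n : ℕ) (M : Type) [AddCommGroup M] [Module R M] :
    C ⊗[R] (K x).H n M ≃ₗ[C] (K (mp C x)).H n (C ⊗[R] M) := by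
  rw [← bc_K]
  exact (K x).bcEquiv C M n

lemma fg_bc [Module.Flat R C] {n : ℕ} (h : (K x).FG n M) : (K (mp C x)).FG n (C ⊗[R] M) := by
  have : Module.Finite R ((K x).H n M) := h
  exact Module.Finite.equiv (bcK x C n M)

lemma fg_of_bc [Module.FaithfullyFlat R C] {n : ℕ} (h : (K (mp C x)).FG n (C ⊗[R] M)) :
    (K x).FG n M := by
  have : Module.Finite C ((K (mp C x)).H n (C ⊗[R] M)) := h
  have : Module.Finite C (C ⊗[R] (K x).H n M) := Module.Finite.equiv (bcK x C n M).symm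
  exact Module.Finite.of_finite_tensorProduct_of_faithfullyFlat C

end Kos

end



set_option linter.unusedSectionVars false
section

open TensorProduct

/-- every element is killed by a power of the ideal -/
def Tors {R : Type} [CommRing R] (I : Ideal R) (M : Type) [AddCommGroup M] [Module R M] : Prop :=
  ∀ m : M, ∃ k : ℕ, ∀ a ∈ I ^ k, a • m = 0

section tors

variable {R : Type} [CommRing R] {I J : Ideal R} {M N : Type} [AddCommGroup M] [Module R M]
  [AddCommGroup N] [Module R N]

lemma Tors.of_inj (h : Tors I M) (f : N →ₗ[R] M) (hf : Function.Injective f) : Tors I N := by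
  intro m
  obtain ⟨k, hk⟩ := h (f m)
  exact ⟨k, fun a ha => hf (by rw [map_smul, hk a ha, map_zero])⟩

lemma Tors.of_surj (h : Tors I M) (f : M →ₗ[R] N) (hf : Function.Surjective f) : Tors I N := by
  intro m
  obtain ⟨m, rfl⟩ := hf m
  obtain ⟨k, hk⟩ := h m
  exact ⟨k, fun a ha => by rw [← map_smul, hk a ha, map_zero]⟩

lemma Tors.mono (h : Tors J M) (hIJ : I ≤ J) : Tors I M := by
  intro m
  obtain ⟨k, hk⟩ := h m
  exact ⟨k, fun a ha => hk a (Ideal.pow_right_mono hIJ k ha)⟩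

/-- annihilator of an element -/
def annE {R : Type} [CommRing R] {M : Type} [AddCommGroup M] [Module R M] (m : M) : Ideal R :=
  LinearMap.ker (LinearMap.toSpanSingleton R M m)

lemma mem_ann {m : M} {a : R} : a ∈ annE (R := R) m ↔ a • m = 0 := by simp [annE]

lemma tors_of_local [IsNoetherianRing R]
    (h : ∀ m : M, ∀ q : Ideal R, q.IsPrime → ¬ I ≤ q → ∃ s ∉ q, s • m = 0) : Tors I M := by
  intro m
  have h1 : I ≤ (annE (R := R) m).radical := by
    rw [Ideal.radical_eq_sInf]
    refine le_sInf ?_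
    rintro q ⟨hq, hp⟩
    by_contra hI
    obtain ⟨s, hs, hsm⟩ := h m q hp hI
    exact hs (hq (mem_ann.mpr hsm))
  obtain ⟨k, hk⟩ := Ideal.exists_pow_le_of_le_radical_of_fg h1 (IsNoetherian.noetherian I)
  exact ⟨k, fun a ha => mem_ann.mp (hk ha)⟩

lemma Tors.bc (C : Type) [CommRing C] [Algebra R C] (h : Tors I M) :
    Tors (I.map (algebraMap R C)) (C ⊗[R] M) := by
  have key : ∀ (k : ℕ) (u : C ⊗[R] M), (∀ a ∈ I ^ k, algebraMap R C a • u = 0) →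
      ∀ c ∈ (I.map (algebraMap R C)) ^ k, c • u = 0 := by
    intro k u hu c hc
    rw [← Ideal.map_pow] at hc
    refine (mem_ann (R := C) (M := C ⊗[R] M)).mp ?_
    refine (Ideal.map_le_iff_le_comap.mpr ?_ :
      (I ^ k).map (algebraMap R C) ≤ annE (R := C) u) hc
    intro a ha
    exact mem_ann.mpr (hu a ha)
  intro u
  induction u with
  | zero => exact ⟨0, fun a _ => smul_zero _⟩
  | add u v hu hv =>
    obtain ⟨k, hk⟩ := hu
    obtain ⟨l, hl⟩ := hv
    refine ⟨k + l, fun a ha => ?_⟩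
    rw [smul_add, hk a (Ideal.pow_le_pow_right (Nat.le_add_right _ _) ha),
      hl a (Ideal.pow_le_pow_right (Nat.le_add_left _ _) ha), add_zero]
  | tmul c m =>
    obtain ⟨k, hk⟩ := h m
    refine ⟨k, key k _ fun a ha => ?_⟩
    rw [algebraMap_smul, ← tmul_smul, hk a ha, tmul_zero]

lemma Tors.finite (h : Tors I M) [Module.Finite R M] : ∃ k, ∀ a ∈ I ^ k, ∀ m : M, a • m = 0 := by
  have key : ∀ P : Submodule R M, P.FG → ∃ k, ∀ a ∈ I ^ k, ∀ m ∈ P, a • m = 0 := by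
    intro P hP
    induction P, hP using Submodule.fg_induction with
    | singleton m =>
      obtain ⟨k, hk⟩ := h m
      refine ⟨k, fun a ha m' hm' => ?_⟩
      obtain ⟨r, rfl⟩ := Submodule.mem_span_singleton.mp hm'
      rw [smul_comm, hk a ha, smul_zero]
    | sup P Q _ _ h1 h2 =>
      obtain ⟨k, hk⟩ := h1
      obtain ⟨l, hl⟩ := h2
      refine ⟨k + l, fun a ha m hm => ?_⟩
      obtain ⟨u, hu, v, hv, rfl⟩ := Submodule.mem_sup.mp hm
      rw [smul_add, hk a (Ideal.pow_le_pow_right (Nat.le_add_right _ _) ha) u hu,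
        hl a (Ideal.pow_le_pow_right (Nat.le_add_left _ _) ha) v hv, add_zero]
  obtain ⟨k, hk⟩ := key ⊤ Module.Finite.fg_top
  exact ⟨k, fun a ha m => hk a ha m trivial⟩

end tors

section art

variable {R : Type} [CommRing R] {M : Type} [AddCommGroup M] [Module R M]

lemma art_single (x : R) (ht : ∀ m : M, ∃ k : ℕ, x ^ k • m = 0)
    [hN : IsArtinian R (Submodule.torsionBy R M x)] : IsArtinian R M := by
  rw [← monotone_stabilizes_iff_artinian]
  intro U
  let U' : ℕ → Submodule R M := fun i => OrderDual.ofDual (U i)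
  have hU : Antitone U' := fun i j hij => U.monotone hij
  have hxs : ∀ i (u : M), u ∈ U' i → ∀ n : ℕ, x ^ n • u ∈ U' i := fun i u hu n =>
    Submodule.smul_mem _ _ hu
  let V : ℕ → ℕ → Submodule R (Submodule.torsionBy R M x) := fun n i =>
    ((U' i).map (x ^ n • (LinearMap.id : M →ₗ[R] M))).comap (Submodule.torsionBy R M x).subtype
  have hV : ∀ n i (z : Submodule.torsionBy R M x), z ∈ V n i ↔ ∃ u ∈ U' i, x ^ n • u = z.1 := by
    intro n i z
    simp [V]
  have hVi : ∀ n i j, i ≤ j → V n j ≤ V n i := by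
    intro n i j hij z hz
    obtain ⟨u, hu, h⟩ := (hV _ _ _).mp hz
    exact (hV _ _ _).mpr ⟨u, hU hij hu, h⟩
  have hVn : ∀ n m i, n ≤ m → V m i ≤ V n i := by
    intro n m i hnm z hz
    obtain ⟨u, hu, h⟩ := (hV _ _ _).mp hz
    refine (hV _ _ _).mpr ⟨x ^ (m - n) • u, hxs i u hu _, ?_⟩
    rw [smul_smul, ← pow_add, Nat.add_sub_cancel' hnm, h]
  have stab : ∀ W : ℕ → Submodule R (Submodule.torsionBy R M x), Antitone W →
      ∃ n, ∀ m, n ≤ m → W n = W m := by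
    intro W hW
    exact monotone_stabilizes_iff_artinian.mpr hN ⟨fun n => OrderDual.toDual (W n),
      fun i j hij => hW hij⟩
  obtain ⟨n0, hn0⟩ := stab (fun n => V n n) (fun i j hij =>
    (hVi j i j hij).trans (hVn i j i hij))
  have hs : ∀ n, ∃ i, ∀ j, i ≤ j → V n i = V n j := fun n =>
    stab (V n) (fun i j hij => hVi n i j hij)
  choose s hs using hs
  let i0 := n0 + ∑ n ∈ Finset.range n0, s n
  have hc : ∀ n i, i0 ≤ i → V n i0 = V n i := by
    intro n i hi
    by_cases hn : n < n0
    · have h1 : s n ≤ i0 := (Finset.single_le_sum (f := s) (fun _ _ => Nat.zero_le _)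
        (Finset.mem_range.mpr hn)).trans (Nat.le_add_left _ _)
      rw [← hs n i0 h1, ← hs n i (h1.trans hi)]
    · push Not at hn
      have h0 : n0 ≤ i0 := Nat.le_add_right _ _
      have key : ∀ i, n0 ≤ i → V n i = V n0 n0 := by
        intro i hi
        apply le_antisymm
        · exact (hVn n0 n i hn).trans (hVi n0 n0 i hi)
        · calc V n0 n0 = V (n + i) (n + i) := hn0 _ (by omega)
            _ ≤ V n (n + i) := hVn _ _ _ (by omega)
            _ ≤ V n i := hVi _ _ _ (by omega)
      rw [key i0 h0, key i (h0.trans hi)]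
  refine ⟨i0, fun i hi => ?_⟩
  apply le_antisymm ?_ ?_
  · exact U.monotone hi
  · change U' i0 ≤ U' i
    have key : ∀ n : ℕ, ∀ v ∈ U' i0, x ^ n • v = 0 → v ∈ U' i := by
      intro n
      induction n with
      | zero => intro v _ h; rw [pow_zero, one_smul] at h; rw [h]; exact zero_mem _
      | succ n ih =>
        intro v hv h
        have hz : x ^ n • v ∈ Submodule.torsionBy R M x := by
          rw [Submodule.mem_torsionBy_iff, smul_smul, ← pow_succ', h]
        have : (⟨x ^ n • v, hz⟩ : Submodule.torsionBy R M x) ∈ V n i0 := (hV _ _ _).mpr ⟨v, hv, rfl⟩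
        rw [hc n i hi] at this
        obtain ⟨u, hu, h2⟩ := (hV _ _ _).mp this
        have h3 := ih (v - u) (sub_mem hv (hU hi hu)) (by rw [smul_sub, h2]; simp)
        have := add_mem h3 hu
        simpa using this
    intro v hv
    obtain ⟨k, hk⟩ := ht v
    exact key k v hv hk

lemma art_finset (s : Finset R) : ∀ (M : Type) [AddCommGroup M] [Module R M],
    (∀ a ∈ s, ∀ m : M, ∃ k : ℕ, a ^ k • m = 0) →
    IsArtinian R (Submodule.torsionBySet R M (s : Set R)) → IsArtinian R M := by
  classical
  induction s using Finset.induction_on with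
  | empty =>
    intro M _ _ _ h
    refine isArtinian_of_injective (LinearMap.codRestrict
      (Submodule.torsionBySet R M ((∅ : Finset R) : Set R)) LinearMap.id (by simp)) ?_
    intro a b h
    exact congrArg Subtype.val h
  | insert a s ha ih =>
    intro M _ _ ht h
    have h1 : IsArtinian R (Submodule.torsionBy R M a) := by
      apply ih
      · intro b hb m
        obtain ⟨k, hk⟩ := ht b (Finset.mem_insert_of_mem hb) m.1
        exact ⟨k, Subtype.ext hk⟩
      · refine isArtinian_of_injective (LinearMap.codRestrict
          (Submodule.torsionBySet R M ((insert a s : Finset R) : Set R))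
          ((Submodule.torsionBy R M a).subtype ∘ₗ Submodule.subtype _) ?_) ?_
        · intro c
          rw [Submodule.mem_torsionBySet_iff]
          rintro ⟨b, hb⟩
          rcases Finset.mem_insert.mp (Finset.mem_coe.mp hb) with rfl | hb
          · exact (Submodule.mem_torsionBy_iff _ _).mp c.1.2
          · have := (Submodule.mem_torsionBySet_iff _ _).mp c.2 ⟨b, hb⟩
            exact congrArg Subtype.val this
        · intro u v huv
          have := congrArg Subtype.val huv
          exact Subtype.ext (Subtype.ext this)
    exact art_single a (ht a (Finset.mem_insert_self _ _))

lemma art_ideal [IsNoetherianRing R] (I : Ideal R) (ht : Tors I M)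
    (h : IsArtinian R (Submodule.torsionBySet R M (I : Set R))) : IsArtinian R M := by
  obtain ⟨s, rfl⟩ := IsNoetherian.noetherian I
  refine art_finset s M ?_ ?_
  · intro a ha m
    obtain ⟨k, hk⟩ := ht m
    exact ⟨k, hk _ (Ideal.pow_mem_pow (Ideal.subset_span ha) k)⟩
  · have : Submodule.torsionBySet R M (s : Set R) =
      Submodule.torsionBySet R M (Submodule.span R (s : Set R) : Set R) :=
      Submodule.torsionBySet_eq_torsionBySet_span _
    rw [this]; exact h

lemma sec_aux [IsNoetherianRing R] (I : Ideal R) [IsArtinian R M] (N : Submodule R M) :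
    ∃ S : Finset (Ideal R), (∀ p ∈ S, p.IsPrime ∧ ¬ I ≤ p) ∧
      ∀ x0, (∀ p ∈ S, x0 ∉ p) → ∃ k : ℕ, ∀ m ∈ N, ∃ m' ∈ N, ∃ u ∈ N,
        (∀ a ∈ I ^ k, a • u = 0) ∧ m = x0 • m' + u := by
  classical
  induction N using WellFoundedLT.induction with
  | ind N ih =>
  by_cases hN : N = ⊥
  · refine ⟨∅, by simp, fun x0 _ => ⟨0, fun m hm => ⟨0, zero_mem _, 0, zero_mem _, by simp, ?_⟩⟩⟩
    rw [hN, Submodule.mem_bot] at hm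
    simp [hm]
  by_cases hsec : ∀ r : R, (∀ m ∈ N, ∃ m' ∈ N, m = r • m') ∨ ∃ k : ℕ, ∀ m ∈ N, r ^ k • m = 0
  · let p : Ideal R :=
      { carrier := {r | ∃ k : ℕ, ∀ m ∈ N, r ^ k • m = 0}
        zero_mem' := ⟨1, fun m _ => by simp⟩
        add_mem' := by
          rintro a b ⟨k, hk⟩ ⟨l, hl⟩
          refine ⟨k + l, fun m hm => ?_⟩
          rw [add_pow, Finset.sum_smul]
          refine Finset.sum_eq_zero fun i hi => ?_
          by_cases h : k ≤ i
          · have : a ^ i * b ^ (k + l - i) * ((k + l).choose i : R) =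
              (a ^ (i - k) * b ^ (k + l - i) * ((k + l).choose i : R)) * a ^ k := by
              conv_lhs => rw [← Nat.sub_add_cancel h, pow_add]
              simp only [Nat.sub_add_cancel h]
              ring
            rw [this, mul_smul, hk m hm, smul_zero]
          · have h' : l ≤ k + l - i := by omega
            have : a ^ i * b ^ (k + l - i) * ((k + l).choose i : R) =
              (a ^ i * b ^ (k + l - i - l) * ((k + l).choose i : R)) * b ^ l := by
              conv_lhs => rw [← Nat.sub_add_cancel h', pow_add]
              ring
            rw [this, mul_smul, hl m hm, smul_zero]
        smul_mem' := by
          rintro c a ⟨k, hk⟩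
          refine ⟨k, fun m hm => ?_⟩
          rw [smul_eq_mul, mul_pow, mul_smul, hk m hm, smul_zero] }
    have hp : ∀ r, r ∈ p ↔ ∃ k : ℕ, ∀ m ∈ N, r ^ k • m = 0 := fun r => Iff.rfl
    have hsurj : ∀ r ∉ p, ∀ m ∈ N, ∃ m' ∈ N, m = r • m' := fun r hr =>
      (hsec r).resolve_right hr
    have hprime : p.IsPrime := by
      refine Ideal.isPrime_iff.mpr ⟨?_, ?_⟩
      · rw [Ideal.ne_top_iff_one, hp]
        rintro ⟨k, hk⟩
        apply hN
        rw [eq_bot_iff]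
        intro m hm
        simpa using hk m hm
      · intro a b hab
        by_contra hcon
        push Not at hcon
        obtain ⟨ha, hb⟩ := hcon
        obtain ⟨k, hk⟩ := (hp _).mp hab
        have ha' : ∀ k : ℕ, ∀ m ∈ N, ∃ m' ∈ N, m = (a * b) ^ k • m' := by
          intro k
          induction k with
          | zero => intro m hm; exact ⟨m, hm, by simp⟩
          | succ k ih =>
            intro m hm
            obtain ⟨m1, h1, rfl⟩ := ih m hm
            obtain ⟨m2, h2, rfl⟩ := hsurj a ha m1 h1
            obtain ⟨m3, h3, rfl⟩ := hsurj b hb m2 h2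
            exact ⟨m3, h3, by rw [smul_smul, smul_smul, pow_succ]; congr 1; ring⟩
        apply hN
        rw [eq_bot_iff]
        intro m hm
        obtain ⟨m', hm', rfl⟩ := ha' k m hm
        rw [hk m' hm']; exact zero_mem _
    by_cases hIp : I ≤ p
    · refine ⟨∅, by simp, fun x0 _ => ?_⟩
      have h1 : I ≤ (Module.annihilator R N).radical := by
        intro a ha
        obtain ⟨k, hk⟩ := (hp a).mp (hIp ha)
        refine ⟨k, Module.mem_annihilator.mpr fun m => Subtype.ext (hk m.1 m.2)⟩
      obtain ⟨k, hk⟩ := Ideal.exists_pow_le_of_le_radical_of_fg h1 (IsNoetherian.noetherian I)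
      refine ⟨k, fun m hm => ⟨0, zero_mem _, m, hm, fun a ha => ?_, by simp⟩⟩
      have := Module.mem_annihilator.mp (hk ha) ⟨m, hm⟩
      exact congrArg Subtype.val this
    · refine ⟨{p}, by simpa using ⟨hprime, hIp⟩, fun x0 hx0 => ⟨0, fun m hm => ?_⟩⟩
      obtain ⟨m', hm', h⟩ := hsurj x0 (hx0 p (Finset.mem_singleton_self _)) _ hm
      exact ⟨m', hm', 0, zero_mem _, by simp, by simpa using h⟩
  · push Not at hsec
    obtain ⟨r, ⟨m0, hm0, hr1⟩, hr2⟩ := hsec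
    let F : ℕ → Submodule R M := fun k => N.map (r ^ k • (LinearMap.id : M →ₗ[R] M))
    have hF : ∀ k m, m ∈ F k ↔ ∃ u ∈ N, r ^ k • u = m := by
      intro k m; simp [F]
    obtain ⟨k, hk⟩ := monotone_stabilizes_iff_artinian.mpr ‹IsArtinian R M›
      ⟨fun k => OrderDual.toDual (F k), by
        intro i j hij
        change F j ≤ F i
        intro m hm
        obtain ⟨u, hu, rfl⟩ := (hF _ _).mp hm
        refine (hF _ _).mpr ⟨r ^ (j - i) • u, N.smul_mem _ hu, ?_⟩
        rw [smul_smul, ← pow_add, Nat.add_sub_cancel' hij]⟩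
    have hk' : ∀ m, k ≤ m → F k = F m := hk
    have hk2 : ∀ u ∈ N, ∃ v ∈ N, r ^ k • u = r ^ (k + (k + 1)) • v := by
      intro u hu
      have : r ^ k • u ∈ F (k + (k + 1)) := by
        rw [← hk' _ (by omega)]; exact (hF _ _).mpr ⟨u, hu, rfl⟩
      obtain ⟨v, hv, h⟩ := (hF _ _).mp this
      exact ⟨v, hv, h.symm⟩
    let N1 : Submodule R M := F (k + 1)
    let N2 : Submodule R M := N ⊓ Submodule.torsionBy R M (r ^ k)
    have h1 : N1 < N := by
      refine lt_of_le_of_ne ?_ ?_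
      · intro m hm
        obtain ⟨u, hu, rfl⟩ := (hF _ _).mp hm
        exact N.smul_mem _ hu
      · intro h
        have : m0 ∈ N1 := by rw [h]; exact hm0
        obtain ⟨u, hu, h2⟩ := (hF _ _).mp this
        refine hr1 (r ^ k • u) (N.smul_mem _ hu) ?_
        rw [← h2, smul_smul, pow_succ']
    have h2 : N2 < N := by
      refine lt_of_le_of_ne inf_le_left ?_
      intro h
      obtain ⟨m, hm, hne⟩ := hr2 k
      rw [← h] at hm
      exact hne ((Submodule.mem_torsionBy_iff _ _).mp hm.2)
    obtain ⟨S1, hS1, H1⟩ := ih N1 h1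
    obtain ⟨S2, hS2, H2⟩ := ih N2 h2
    refine ⟨S1 ∪ S2, ?_, ?_⟩
    · intro p hp
      rcases Finset.mem_union.mp hp with h | h
      · exact hS1 p h
      · exact hS2 p h
    · intro x0 hx0
      obtain ⟨k1, hk1⟩ := H1 x0 (fun p hp => hx0 p (Finset.mem_union_left _ hp))
      obtain ⟨k2, hk2'⟩ := H2 x0 (fun p hp => hx0 p (Finset.mem_union_right _ hp))
      refine ⟨k1 + k2, fun m hm => ?_⟩
      obtain ⟨v, hv, h⟩ := hk2 m hm
      have e1 : r ^ (k + 1) • v ∈ N1 := (hF _ _).mpr ⟨v, hv, rfl⟩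
      have e2 : m - r ^ (k + 1) • v ∈ N2 := by
        refine ⟨sub_mem hm (N.smul_mem _ hv), ?_⟩
        refine (Submodule.mem_torsionBy_iff _ _).mpr ?_
        rw [smul_sub, smul_smul, ← pow_add, h, sub_self]
      obtain ⟨m1, hm1, u1, hu1, f1, g1⟩ := hk1 _ e1
      obtain ⟨m2, hm2, u2, hu2, f2, g2⟩ := hk2' _ e2
      refine ⟨m1 + m2, add_mem (h1.le hm1) (h2.le hm2), u1 + u2,
        add_mem (h1.le hu1) (h2.le hu2), fun a ha => ?_, ?_⟩
      · rw [smul_add, f1 a (Ideal.pow_le_pow_right (Nat.le_add_right _ _) ha),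
          f2 a (Ideal.pow_le_pow_right (Nat.le_add_left _ _) ha), add_zero]
      · rw [smul_add, add_add_add_comm, ← g1, ← g2, add_sub_cancel]

lemma sec [IsNoetherianRing R] (I : Ideal R) (M : Type) [AddCommGroup M] [Module R M]
    [IsArtinian R M] :
    ∃ S : Finset (Ideal R), (∀ p ∈ S, p.IsPrime ∧ ¬ I ≤ p) ∧
      ∀ x0, (∀ p ∈ S, x0 ∉ p) → ∃ k : ℕ, ∀ m : M, ∃ m' u : M,
        (∀ a ∈ I ^ k, a • u = 0) ∧ m = x0 • m' + u := by
  obtain ⟨S, h1, h2⟩ := sec_aux I (⊤ : Submodule R M)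
  refine ⟨S, h1, fun x0 hx0 => ?_⟩
  obtain ⟨k, hk⟩ := h2 x0 hx0
  refine ⟨k, fun m => ?_⟩
  obtain ⟨m', _, u, _, h⟩ := hk m trivial
  exact ⟨m', u, h⟩

/-- prime avoidance with one extra ideal -/
lemma avoid {I J : Ideal R} (S : Finset (Ideal R)) (hS : ∀ p ∈ S, p.IsPrime ∧ ¬ I ≤ p)
    (hJ : ¬ I ≤ J) : ∃ a ∈ I, a ∉ J ∧ ∀ p ∈ S, a ∉ p := by
  classical
  by_contra hcon
  push Not at hcon
  have h := (Ideal.subset_union_prime (R := R) (s := insert J S) (f := id) J J (by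
    intro p hp h1 _
    exact (hS p ((Finset.mem_insert.mp hp).resolve_left h1)).1) (I := I)).mp (by
    intro a ha
    by_cases haJ : a ∈ J
    · exact Set.mem_biUnion (Finset.mem_coe.mpr (Finset.mem_insert_self _ _)) haJ
    · obtain ⟨p, hp, hap⟩ := hcon a ha haJ
      exact Set.mem_biUnion (Finset.mem_coe.mpr (Finset.mem_insert_of_mem hp)) hap)
  obtain ⟨p, hp, hle⟩ := h
  rcases Finset.mem_insert.mp hp with rfl | hp
  · exact hJ hle
  · exact (hS p hp).2 hle

end art

end



set_option linter.unusedSectionVars false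
section

open TensorProduct

section mult

variable {R : Type} [CommRing R] {M : Type} [AddCommGroup M] [Module R M]

/-- multiplication by an element -/
abbrev mu (a : R) (M : Type) [AddCommGroup M] [Module R M] : M →ₗ[R] M := a • LinearMap.id

lemma mu_exact1 (a : R) : Function.Exact (LinearMap.ker (mu a M)).subtype (mu a M).rangeRestrict := by
  intro m
  rw [← Subtype.coe_inj]
  constructor
  · intro h; exact ⟨⟨m, h⟩, rfl⟩
  · rintro ⟨u, rfl⟩; exact u.2

lemma mu_exact2 (a : R) : Function.Exact (LinearMap.range (mu a M)).subtype
    (LinearMap.range (mu a M)).mkQ := LinearMap.exact_subtype_mkQ _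

lemma mem_ker_mu {a : R} {m : M} : m ∈ LinearMap.ker (mu a M) ↔ a • m = 0 := by simp

lemma mem_range_mu {a : R} {m : M} : m ∈ LinearMap.range (mu a M) ↔ ∃ u, a • u = m := by simp

/-- the torsion submodule -/
def Gam (I : Ideal R) (M : Type) [AddCommGroup M] [Module R M] : Submodule R M where
  carrier := {m | ∃ k : ℕ, ∀ a ∈ I ^ k, a • m = 0}
  zero_mem' := ⟨0, by simp⟩
  add_mem' := by
    rintro u v ⟨k, hk⟩ ⟨l, hl⟩
    refine ⟨k + l, fun a ha => ?_⟩
    rw [smul_add, hk a (Ideal.pow_le_pow_right (Nat.le_add_right _ _) ha),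
      hl a (Ideal.pow_le_pow_right (Nat.le_add_left _ _) ha), add_zero]
  smul_mem' := by
    rintro c u ⟨k, hk⟩
    exact ⟨k, fun a ha => by rw [smul_comm, hk a ha, smul_zero]⟩

lemma Gam_tors (I : Ideal R) : Tors I (Gam I M) := by
  rintro ⟨m, k, hk⟩
  exact ⟨k, fun a ha => Subtype.ext (hk a ha)⟩

lemma mem_Gam_of_local [IsNoetherianRing R] {I : Ideal R} {m : M}
    (h : ∀ q : Ideal R, q.IsPrime → ¬ I ≤ q → ∃ s ∉ q, s • m = 0) : m ∈ Gam I M := by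
  have h1 : Tors I (R ∙ m) := by
    apply tors_of_local
    rintro ⟨u, hu⟩ q hq hI
    obtain ⟨r, rfl⟩ := Submodule.mem_span_singleton.mp hu
    obtain ⟨s, hs, h2⟩ := h q hq hI
    exact ⟨s, hs, Subtype.ext (by simp [smul_comm s r, h2])⟩
  obtain ⟨k, hk⟩ := h1 ⟨m, Submodule.mem_span_singleton_self m⟩
  exact ⟨k, fun a ha => congrArg Subtype.val (hk a ha)⟩

lemma Tors.exists_not_mem {I : Ideal R} (h : Tors I M) (m : M) (q : Ideal R) [q.IsPrime]
    (hq : ¬ I ≤ q) : ∃ s ∉ q, s • m = 0 := by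
  obtain ⟨k, hk⟩ := h m
  obtain ⟨s, hs, hsq⟩ := SetLike.not_le_iff_exists.mp hq
  exact ⟨s ^ k, fun hh => hsq (Ideal.IsPrime.mem_of_pow_mem ‹_› k hh),
    hk _ (Ideal.pow_mem_pow hs k)⟩

lemma Tors.of_primes [IsNoetherianRing R] {I J : Ideal R} (h : Tors I M)
    (hp : ∀ q : Ideal R, q.IsPrime → I ≤ q → J ≤ q) : Tors J M := by
  apply tors_of_local
  intro m q hq hJ
  exact h.exists_not_mem m q fun hI => hJ (hp q hq hI)

lemma loc_zero (p : Ideal R) [p.IsPrime] (m : M)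
    (h : ((1 : Localization.AtPrime p) ⊗ₜ[R] m) = 0) : ∃ s ∉ p, s • m = 0 := by
  have : IsLocalizedModule p.primeCompl (TensorProduct.mk R (Localization.AtPrime p) M 1) :=
    inferInstance
  obtain ⟨s, hs⟩ := (IsLocalizedModule.eq_zero_iff p.primeCompl
    (TensorProduct.mk R (Localization.AtPrime p) M 1)).mp h
  exact ⟨s.1, s.2, hs⟩

end mult

namespace Kos

variable {R : Type} [CommRing R] [IsNoetherianRing R] {t : ℕ} (x : Fin t → R)

/-- all Koszul cohomology is finitely generated -/
def Cof (M : Type) [AddCommGroup M] [Module R M] : Prop := ∀ n, (K x).FG n M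

variable {M : Type} [AddCommGroup M] [Module R M]

/-- the ideal generated by the sequence -/
abbrev idl (x : Fin t → R) : Ideal R := Ideal.span (Set.range x)

lemma tors_pow_fg (h : (K x).FG 0 M) (k : ℕ) :
    Module.Finite R (Submodule.torsionBySet R M ((idl x ^ k : Ideal R) : Set R)) := by
  have h1 := (fg_zero_iff x).mp h
  induction k with
  | zero =>
    have : Subsingleton (Submodule.torsionBySet R M ((idl x ^ 0 : Ideal R) : Set R)) := by
      refine ⟨fun a b => ?_⟩
      have : ∀ c : Submodule.torsionBySet R M ((idl x ^ 0 : Ideal R) : Set R), c = 0 := by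
        rintro ⟨c, hc⟩
        have := (Submodule.mem_torsionBySet_iff _ _).mp hc ⟨1, by simp⟩
        exact Subtype.ext (by simpa using this)
      rw [this a, this b]
    exact Module.Finite.of_finite
  | succ k ih =>
    let φ : Submodule.torsionBySet R M ((idl x ^ (k + 1) : Ideal R) : Set R) →ₗ[R]
        (Fin t → Submodule.torsionBySet R M ((idl x ^ k : Ideal R) : Set R)) :=
      LinearMap.pi fun i => (mu (x i) M).restrict (by
        intro m hm
        rw [Submodule.mem_torsionBySet_iff] at hm ⊢
        rintro ⟨a, ha⟩
        change a • x i • m = 0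
        rw [smul_smul]
        exact hm ⟨a * x i, by
          rw [SetLike.mem_coe, pow_succ]
          exact Ideal.mul_mem_mul ha (Ideal.subset_span ⟨i, rfl⟩)⟩)
    have hker : (LinearMap.ker φ).FG := by
      have hfin : Module.Finite R (Submodule.torsionBySet R M (idl x : Set R)) :=
        Module.Finite.iff_fg.mpr h1
      have : ∀ u : LinearMap.ker φ, u.1.1 ∈ Submodule.torsionBySet R M (idl x : Set R) := by
        intro u
        rw [← Submodule.torsionBySet_eq_torsionBySet_span, Submodule.mem_torsionBySet_iff]
        rintro ⟨_, i, rfl⟩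
        have := congrArg Subtype.val (congrFun (LinearMap.mem_ker.mp u.2) i)
        exact this
      have hf := Module.Finite.of_injective (((Submodule.subtype _ ∘ₗ Submodule.subtype _)).codRestrict
        (Submodule.torsionBySet R M (idl x : Set R)) this) (by
          intro u v huv
          have h3 := congrArg Subtype.val huv
          exact Subtype.ext (Subtype.ext h3))
      exact Module.Finite.iff_fg.mp hf
    rw [Module.finite_def]
    apply Submodule.fg_of_fg_map_of_fg_inf_ker φ
    · rw [← LinearMap.range_eq_map]
      exact Module.Finite.iff_fg.mp inferInstance
    · simpa using hker

lemma fin_of_kill (h : (K x).FG 0 M) {k : ℕ} (hk : ∀ a ∈ idl x ^ k, ∀ m : M, a • m = 0) :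
    Module.Finite R M := by
  have := tors_pow_fg x h k
  refine Module.Finite.of_injective (LinearMap.codRestrict
    (Submodule.torsionBySet R M ((idl x ^ k : Ideal R) : Set R)) LinearMap.id ?_) ?_
  · intro m
    rw [Submodule.mem_torsionBySet_iff]
    rintro ⟨a, ha⟩
    exact hk a ha m
  · intro u v huv
    exact congrArg Subtype.val huv

lemma lemX (a : R) (ha : a ∈ idl x) (h1 : Cof x (LinearMap.ker (mu a M)))
    (h2 : Cof x (M ⧸ LinearMap.range (mu a M))) : Cof x M := by
  intro n
  have k1 : (LinearMap.ker ((K x).map n (mu a M).rangeRestrict)).FG :=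
    (K x).ker_map_g_fg Subtype.val_injective (mu_exact1 a) (LinearMap.surjective_rangeRestrict _) n
      (h1 n)
  have k2 : (LinearMap.ker ((K x).map n (LinearMap.range (mu a M)).subtype)).FG := by
    cases n with
    | zero =>
      rw [(K x).ker_map_f_zero Subtype.val_injective]
      exact Submodule.fg_bot
    | succ n =>
      exact (K x).ker_map_f_fg Subtype.val_injective (mu_exact2 a) (Submodule.mkQ_surjective _) n
        (h2 n)
  have k3 := fg_of_ker_comp _ _ k1 k2
  unfold MC.FG
  rw [Module.finite_def]
  convert k3
  rw [eq_comm, eq_top_iff]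
  intro e _
  rw [LinearMap.mem_ker, LinearMap.comp_apply, MC.map_comp]
  have : (LinearMap.range (mu a M)).subtype ∘ₗ (mu a M).rangeRestrict = mu a M := by
    ext; rfl
  rw [this, MC.map_smul_id]
  exact kill x n a ha e

lemma art_of_fg (m : Ideal R) [m.IsMaximal] (hx : idl x ≤ m) (ht : Tors m M) (h : (K x).FG 0 M) :
    IsArtinian R M := by
  apply art_ideal m ht
  have h1 := (fg_zero_iff x).mp h
  have h2 : (Submodule.torsionBySet R M (m : Set R)).FG :=
    Submodule.FG.of_le h1 (Submodule.torsionBySet_le_torsionBySet_of_subset hx)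
  have : Module.Finite R (Submodule.torsionBySet R M (m : Set R)) := Module.Finite.iff_fg.mpr h2
  let _ : Field (R ⧸ m) := Ideal.Quotient.field m
  have : Module.Finite (R ⧸ m) (Submodule.torsionBySet R M (m : Set R)) :=
    Module.Finite.of_restrictScalars_finite R _ _
  have : IsArtinian (R ⧸ m) (Submodule.torsionBySet R M (m : Set R)) := inferInstance
  exact isArtinian_of_surjective_algebraMap (R := R ⧸ m) Ideal.Quotient.mk_surjective

lemma cof_of_finite [Module.Finite R M] : Cof x M := fun n => (K x).fg_of_finite n

lemma lt_sup_of_not_mem {I : Ideal R} {a : R} (ha : a ∉ I) : I < I ⊔ Ideal.span {a} :=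
  lt_of_le_of_ne le_sup_left fun h => ha (h ▸ Ideal.mem_sup_right (Ideal.mem_span_singleton_self a))

lemma kill_sup {I : Ideal R} {a : R} (hI : ∀ b ∈ I, ∀ m : M, b • m = 0) :
    ∀ b ∈ I ⊔ Ideal.span {a}, ∀ m : LinearMap.ker (mu a M), b • m = 0 := by
  intro b hb m
  obtain ⟨u, hu, v, hv, rfl⟩ := Submodule.mem_sup.mp hb
  obtain ⟨c, rfl⟩ := Ideal.mem_span_singleton'.mp hv
  apply Subtype.ext
  change (u + c * a) • m.1 = 0
  rw [add_smul, hI u hu, mul_smul, mem_ker_mu.mp m.2, smul_zero, add_zero]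

theorem P0 (m : Ideal R) [m.IsMaximal] (hx : idl x ≤ m) (ht : Tors m M) (h : (K x).FG 0 M) :
    Cof x M := by
  have key : ∀ I : Ideal R, I ≤ idl x → ∀ (N : Type) [AddCommGroup N] [Module R N],
      (∀ a ∈ I, ∀ n : N, a • n = 0) → Tors m N → (K x).FG 0 N → Cof x N := by
    intro I
    induction I using WellFoundedGT.induction with
    | ind I ih =>
    intro hI N _ _ hk hT h0
    by_cases hIx : idl x ≤ I
    · have := fin_of_kill x h0 (k := 1) (fun a ha n => hk a (hIx (by simpa using ha)) n)
      exact cof_of_finite x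
    have := art_of_fg x m hx hT h0
    obtain ⟨S, hS1, hS2⟩ := sec (idl x) N
    obtain ⟨a, ha, haI, haS⟩ := avoid S hS1 hIx
    obtain ⟨k, hk2⟩ := hS2 a haS
    apply lemX x a ha
    · refine ih (I ⊔ Ideal.span {a}) (lt_sup_of_not_mem haI) ?_ _ (kill_sup hk) ?_ ?_
      · exact sup_le hI ((Ideal.span_singleton_le_iff_mem _).mpr ha)
      · exact hT.of_inj (Submodule.subtype _) Subtype.val_injective
      · exact (K x).fg_left_zero (f := (LinearMap.ker (mu a N)).subtype) Subtype.val_injective h0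
    · have := tors_pow_fg x h0 k
      have : Module.Finite R (N ⧸ LinearMap.range (mu a N)) := by
        refine Module.Finite.of_surjective ((LinearMap.range (mu a N)).mkQ ∘ₗ
          (Submodule.torsionBySet R N ((idl x ^ k : Ideal R) : Set R)).subtype) ?_
        intro c
        obtain ⟨n, rfl⟩ := Submodule.mkQ_surjective _ c
        obtain ⟨n', u, hu, rfl⟩ := hk2 n
        refine ⟨⟨u, (Submodule.mem_torsionBySet_iff _ _).mpr fun b => hu b.1 b.2⟩, ?_⟩
        simp only [LinearMap.comp_apply, Submodule.subtype_apply, map_add]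
        rw [right_eq_add]
        exact (Submodule.Quotient.mk_eq_zero _).mpr ⟨n', rfl⟩
      exact cof_of_finite x
  exact key ⊥ bot_le M (by simp) ht h

end Kos

end



set_option linter.unusedSectionVars false
section

open TensorProduct

namespace Kos

variable {R : Type} [CommRing R] [IsNoetherianRing R] {t : ℕ} (x : Fin t → R)
variable {M : Type} [AddCommGroup M] [Module R M]

lemma loc_comap_le (p : Ideal R) [p.IsPrime] (q : Ideal (Localization.AtPrime p))
    (hq : q.IsPrime) : q.comap (algebraMap R (Localization.AtPrime p)) ≤ p := by
  have h1 := Ideal.comap_mono (f := algebraMap R (Localization.AtPrime p))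
    (IsLocalRing.le_maximalIdeal hq.ne_top)
  have h2 := IsLocalization.AtPrime.under_maximalIdeal (Localization.AtPrime p) p
  exact h1.trans h2.le

lemma loc_max_le (p : Ideal R) [p.IsPrime] (q : Ideal (Localization.AtPrime p))
    (h : q.comap (algebraMap R (Localization.AtPrime p)) = p) :
    IsLocalRing.maximalIdeal (Localization.AtPrime p) ≤ q := by
  have h1 := IsLocalization.AtPrime.map_eq_maximalIdeal p (Localization.AtPrime p)
  exact h1.ge.trans (Ideal.map_le_iff_le_comap.mpr h.ge)

lemma locsec (b : Ideal R) (hxb : idl x ≤ b) (p : Ideal R) [p.IsPrime]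
    (hbp : b ≤ p) (hmin : ∀ q : Ideal R, q.IsPrime → b ≤ q → ¬ q < p)
    (ht : Tors b M) (h0 : (K x).FG 0 M) :
    ∃ S : Finset (Ideal R), (∀ q ∈ S, q.IsPrime ∧ ¬ idl x ≤ q) ∧
      ∀ a, (∀ q ∈ S, a ∉ q) → ∃ k : ℕ, ∀ c ∈ idl x ^ k, ∀ n : M ⧸ LinearMap.range (mu a M),
        ∃ s ∉ p, s • c • n = 0 := by
  classical
  let C := Localization.AtPrime p
  let f := algebraMap R C
  have hT1 : Tors (b.map f) (C ⊗[R] M) := ht.bc C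
  have hT2 : Tors (IsLocalRing.maximalIdeal C) (C ⊗[R] M) := by
    refine hT1.of_primes ?_
    intro q hq hb
    have h1 : b ≤ q.comap f := Ideal.map_le_iff_le_comap.mp hb
    have h2 : q.comap f ≤ p := loc_comap_le p q hq
    have h3 : q.comap f = p := by
      by_contra hne
      exact hmin _ (Ideal.comap_isPrime f q) h1 (lt_of_le_of_ne h2 hne)
    exact loc_max_le p q h3
  have hxm : idl (mp C x) ≤ IsLocalRing.maximalIdeal C := by
    rw [show idl (mp C x) = _ from span_mp x C, ← IsLocalization.AtPrime.map_eq_maximalIdeal p C]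
    exact Ideal.map_mono (hxb.trans hbp)
  have hart := art_of_fg (mp C x) (IsLocalRing.maximalIdeal C) hxm hT2 (fg_bc x C h0)
  obtain ⟨S, hS1, hS2⟩ := sec (idl (mp C x)) (C ⊗[R] M)
  refine ⟨S.image (Ideal.comap f), ?_, ?_⟩
  · intro q hq
    obtain ⟨q', hq', rfl⟩ := Finset.mem_image.mp hq
    have := (hS1 q' hq').1
    refine ⟨Ideal.comap_isPrime f q', fun h => (hS1 q' hq').2 ?_⟩
    rw [show idl (mp C x) = _ from span_mp x C]
    exact Ideal.map_le_iff_le_comap.mpr h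
  · intro a ha
    obtain ⟨k, hk⟩ := hS2 (f a) (fun q hq h => ha _ (Finset.mem_image_of_mem _ hq) h)
    refine ⟨k, fun c hc n => ?_⟩
    obtain ⟨n, rfl⟩ := Submodule.mkQ_surjective _ n
    apply loc_zero p
    obtain ⟨n', u, hu, h⟩ := hk (1 ⊗ₜ n)
    let π := (LinearMap.range (mu a M)).mkQ.lTensor C
    have h2 : π (f c • (1 ⊗ₜ n)) = (1 : C) ⊗ₜ[R] (c • (LinearMap.range (mu a M)).mkQ n) := by
      change π (algebraMap R C c • _) = _
      rw [algebraMap_smul, map_smul, tmul_smul]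
      rfl
    rw [← h2, h, smul_add, hu (f c), add_zero, smul_comm]
    · change π (algebraMap R C a • _) = _
      rw [algebraMap_smul, map_smul]
      generalize π (f c • n') = w
      induction w with
      | zero => simp
      | add u v hu hv => rw [smul_add, hu, hv, add_zero]
      | tmul c n =>
        obtain ⟨n, rfl⟩ := Submodule.mkQ_surjective _ n
        rw [← tmul_smul, ← map_smul]
        have : (LinearMap.range (mu a M)).mkQ (a • n) = 0 :=
          (Submodule.Quotient.mk_eq_zero _).mpr ⟨n, rfl⟩
        rw [this, tmul_zero]
    · rw [show idl (mp C x) = _ from span_mp x C, ← Ideal.map_pow]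
      exact Ideal.mem_map_of_mem f hc

theorem P1 [IsLocalRing R] (b : Ideal R) (hxb : idl x ≤ b)
    (hbm : b ≤ IsLocalRing.maximalIdeal R)
    (hD : ∀ p q : Ideal R, p.IsPrime → q.IsPrime → b ≤ p → p < q → q = IsLocalRing.maximalIdeal R)
    (ht : Tors b M) (h0 : (K x).FG 0 M) (h1 : (K x).FG 1 M) : Cof x M := by
  classical
  have hfin : {p : Ideal R | p.IsPrime ∧ b ≤ p ∧ p ≠ IsLocalRing.maximalIdeal R}.Finite := by
    refine (Ideal.finite_minimalPrimes_of_isNoetherianRing R b).subset ?_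
    rintro p ⟨hp, hbp, hne⟩
    refine ⟨⟨hp, hbp⟩, ?_⟩
    rintro q ⟨hq, hbq⟩ hqp
    rcases lt_or_eq_of_le hqp with h | h
    · exact absurd (hD q p hq hp hbq h) hne
    · exact h.ge
  have key : ∀ I : Ideal R, I ≤ idl x → ∀ (N : Type) [AddCommGroup N] [Module R N],
      (∀ a ∈ I, ∀ n : N, a • n = 0) → Tors b N → (K x).FG 0 N → (K x).FG 1 N → Cof x N := by
    intro I
    induction I using WellFoundedGT.induction with
    | ind I ih =>
    intro hI N _ _ hk hT h0 h1
    by_cases hIx : idl x ≤ I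
    · have := fin_of_kill x h0 (k := 1) (fun a ha n => hk a (hIx (by simpa using ha)) n)
      exact cof_of_finite x
    have hS : ∀ p : Ideal R, ∃ S : Finset (Ideal R), (∀ q ∈ S, q.IsPrime ∧ ¬ idl x ≤ q) ∧
      ∀ a, (∀ q ∈ S, a ∉ q) → ∃ k : ℕ, ∀ c ∈ idl x ^ k, ∀ n : N ⧸ LinearMap.range (mu a N),
        p ∈ hfin.toFinset → ∃ s ∉ p, s • c • n = 0 := by
      intro p
      by_cases hp : p ∈ hfin.toFinset
      · obtain ⟨hp1, hp2, hp3⟩ := hfin.mem_toFinset.mp hp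
        obtain ⟨S, hS, hS2⟩ := locsec x b hxb p hp2
          (fun q hq hbq hlt => hp3 (hD q p hq hp1 hbq hlt)) hT h0
        refine ⟨S, hS, fun a ha => ?_⟩
        obtain ⟨k, hk⟩ := hS2 a ha
        exact ⟨k, fun c hc n _ => hk c hc n⟩
      · exact ⟨∅, by simp, fun a _ => ⟨0, fun c _ n h => absurd h hp⟩⟩
    choose S hS1 hS2 using hS
    obtain ⟨a, ha, haI, haS⟩ := avoid (I := idl x) (J := I) (hfin.toFinset.biUnion S) (by
      intro p hp
      obtain ⟨q, _, hq⟩ := Finset.mem_biUnion.mp hp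
      exact hS1 q p hq) hIx
    have hk2 : ∀ p : Ideal R, ∃ k : ℕ, ∀ c ∈ idl x ^ k, ∀ n : N ⧸ LinearMap.range (mu a N),
        p ∈ hfin.toFinset → ∃ s ∉ p, s • c • n = 0 := by
      intro p
      by_cases hp : p ∈ hfin.toFinset
      · exact hS2 p a (fun q hq => haS q (Finset.mem_biUnion.mpr ⟨p, hp, hq⟩))
      · exact ⟨0, fun c _ n h => absurd h hp⟩
    choose k hk2 using hk2
    let kk := ∑ p ∈ hfin.toFinset, k p
    -- kernel part
    have i1 : Function.Injective (LinearMap.ker (mu a N)).subtype := Subtype.val_injective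
    have i2 : Function.Injective (LinearMap.range (mu a N)).subtype := Subtype.val_injective
    have s1 := LinearMap.surjective_rangeRestrict (mu a N)
    have s2 := Submodule.mkQ_surjective (LinearMap.range (mu a N))
    have r0 : (K x).FG 0 (LinearMap.range (mu a N)) := (K x).fg_left_zero i2 h0
    have n1 : (K x).FG 1 (LinearMap.ker (mu a N)) := (K x).fg_left i1 (mu_exact1 a) s1 r0 h1
    have hcofk : Cof x (LinearMap.ker (mu a N)) := by
      refine ih (I ⊔ Ideal.span {a}) (lt_sup_of_not_mem haI) ?_ _ (kill_sup hk) ?_ ?_ n1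
      · exact sup_le hI ((Ideal.span_singleton_le_iff_mem _).mpr ha)
      · exact hT.of_inj (Submodule.subtype _) Subtype.val_injective
      · exact (K x).fg_left_zero i1 h0
    apply lemX x a ha hcofk
    have r1 : (K x).FG 1 (LinearMap.range (mu a N)) :=
      (K x).fg_right i1 (mu_exact1 a) s1 h1 (hcofk 2)
    have c0 : (K x).FG 0 (N ⧸ LinearMap.range (mu a N)) :=
      (K x).fg_right i2 (mu_exact2 a) s2 h0 r1
    have hTC : Tors b (N ⧸ LinearMap.range (mu a N)) := hT.of_surj _ s2
    let G := Gam (IsLocalRing.maximalIdeal R) (N ⧸ LinearMap.range (mu a N))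
    have i3 : Function.Injective G.subtype := Subtype.val_injective
    have s3 := Submodule.mkQ_surjective G
    have hG : Cof x G := P0 x (IsLocalRing.maximalIdeal R) (hxb.trans hbm) (Gam_tors _)
      ((K x).fg_left_zero i3 c0)
    have q0 : (K x).FG 0 ((N ⧸ LinearMap.range (mu a N)) ⧸ G) :=
      (K x).fg_right i3 (LinearMap.exact_subtype_mkQ G) s3 c0 (hG 1)
    have : Module.Finite R ((N ⧸ LinearMap.range (mu a N)) ⧸ G) := by
      refine fin_of_kill x q0 (k := kk) ?_
      intro c hc n
      obtain ⟨n, rfl⟩ := s3 n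
      rw [← map_smul]
      refine (Submodule.Quotient.mk_eq_zero _).mpr ?_
      apply mem_Gam_of_local
      intro q hq hmq
      by_cases hbq : b ≤ q
      · have hq' : q ∈ hfin.toFinset := hfin.mem_toFinset.mpr ⟨hq, hbq, fun h => hmq h.ge⟩
        refine hk2 q c (Ideal.pow_le_pow_right ?_ hc) n hq'
        exact Finset.single_le_sum (f := k) (fun _ _ => Nat.zero_le _) hq'
      · exact hTC.exists_not_mem _ q hbq
    intro n
    exact (K x).fg_mid i3 (LinearMap.exact_subtype_mkQ G) s3 (hG n) (cof_of_finite x n)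
  exact key ⊥ bot_le M (by simp) ht h0 h1

end Kos

end



set_option linter.unusedSectionVars false
section

open TensorProduct

/-- a linear map with finitely generated cokernel -/
def CoF {R : Type} [CommRing R] {X Y : Type} [AddCommGroup X] [Module R X] [AddCommGroup Y]
    [Module R Y] (f : X →ₗ[R] Y) : Prop := ∃ F : Submodule R Y, F.FG ∧ F ⊔ LinearMap.range f = ⊤

section cof

variable {R : Type} [CommRing R] {X Y Z : Type} [AddCommGroup X] [Module R X] [AddCommGroup Y]
    [Module R Y] [AddCommGroup Z] [Module R Z]

lemma CoF.comp {f : X →ₗ[R] Y} {g : Y →ₗ[R] Z} (hf : CoF f) (hg : CoF g) : CoF (g ∘ₗ f) := by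
  obtain ⟨F, hF, h1⟩ := hf
  obtain ⟨G, hG, h2⟩ := hg
  refine ⟨G ⊔ F.map g, hG.sup (hF.map g), ?_⟩
  rw [LinearMap.range_comp, sup_assoc, ← Submodule.map_sup, h1, ← LinearMap.range_eq_map, h2]

lemma CoF.of_finite {f : X →ₗ[R] Y} (h : Module.Finite R (Y ⧸ LinearMap.range f)) : CoF f := by
  obtain ⟨n, s, hs⟩ := Module.Finite.exists_fin (R := R) (M := Y ⧸ LinearMap.range f)
  choose r hr using Submodule.mkQ_surjective (LinearMap.range f)
  refine ⟨Submodule.span R (Set.range (r ∘ s)), Submodule.fg_span (Set.finite_range _), ?_⟩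
  have : (LinearMap.range f).mkQ ∘ r ∘ s = s := by funext i; exact hr _
  rw [sup_comm, ← Submodule.map_mkQ_eq_top, Submodule.map_span, ← Set.range_comp, this, hs]

end cof

namespace MC

variable {R : Type} [CommRing R] [IsNoetherianRing R] (P : MC R)
variable {M M' M'' : Type} [AddCommGroup M] [Module R M] [AddCommGroup M'] [Module R M']
  [AddCommGroup M''] [Module R M'']
variable {f : M' →ₗ[R] M} {g : M →ₗ[R] M''}

lemma coker_map_g (hf : Function.Injective f) (hfg : Function.Exact f g)
    (hg : Function.Surjective g) {n : ℕ} (h' : P.FG (n + 1) M') : CoF (P.map n g) := by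
  have : Module.Finite R (P.H (n + 1) M') := h'
  have h2 : (LinearMap.range ((LinearMap.range (P.map n g)).mkQ ∘ₗ P.pairFst hfg n)).FG := by
    apply fg_range_of _ (P.pairSnd hf (n + 1))
    convert Submodule.fg_bot
    rw [eq_bot_iff]
    rintro _ ⟨p, hp, rfl⟩
    obtain ⟨u, hu⟩ := (P.cls_eq_zero (n + 1) _).mp (LinearMap.mem_ker.mp hp)
    have hu' : P.d (n + 1) M' u = p.1.2 := hu
    have hp2 := (P.mem_pairs (f := f) p.1).mp p.2
    have hz : P.d (n + 1) M (p.1.1 - fun i => f (u i)) = 0 := by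
      rw [map_sub, hp2, d_comp, hu', sub_self]
    refine (Submodule.Quotient.mk_eq_zero _).mpr ?_
    refine ⟨P.cls n M ⟨_, hz⟩, ?_⟩
    rw [map_cls]
    refine congrArg (P.cls n M'') (Subtype.ext ?_)
    ext i
    change g (p.1.1 i - f (u i)) = g (p.1.1 i)
    rw [map_sub, hfg.apply_apply_eq_zero, sub_zero]
  have h3 : LinearMap.range (P.pairFst hfg n) = ⊤ := by
    rw [eq_top_iff]
    rintro e -
    obtain ⟨⟨z, hz⟩, rfl⟩ := P.cls_surj _ e
    choose s hs using hg
    set w : P.ι (n + 1) → M := fun i => s (z i)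
    have hw : (fun i => g (w i)) = z := funext fun i => hs _
    have h1 : ∀ i, ∃ y, f y = (P.d (n + 1) M w) i := by
      intro i
      refine (hfg _).mp ?_
      have := congrFun (P.d_comp (n + 1) g w) i
      rw [hw, LinearMap.mem_ker.mp hz] at this
      simpa using this.symm
    choose u hu using h1
    refine ⟨⟨(w, u), ?_⟩, ?_⟩
    · exact (P.mem_pairs (f := f) _).mpr (funext fun i => (hu i).symm)
    · exact congrArg (P.cls n M'') (Subtype.ext hw)
  apply CoF.of_finite
  rw [LinearMap.range_comp, h3, ← LinearMap.range_eq_map, Submodule.range_mkQ] at h2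
  exact ⟨h2⟩

lemma coker_map_f (hf : Function.Injective f) (hfg : Function.Exact f g)
    (hg : Function.Surjective g) {n : ℕ} (h' : P.FG n M'') : CoF (P.map n f) := by
  have : Module.Finite R (P.H n M'') := h'
  apply CoF.of_finite
  have h1 : ∀ e, e ∈ LinearMap.range (P.map n f) → P.map n g e = 0 := by
    rintro _ ⟨e, rfl⟩
    rw [map_comp]
    have : g ∘ₗ f = 0 := by ext u; exact hfg.apply_apply_eq_zero u
    rw [this]
    obtain ⟨z, rfl⟩ := P.cls_surj _ e
    rw [map_cls]
    have : P.mapZ (n + 1) (0 : M' →ₗ[R] M'') z = 0 := Subtype.ext (by ext; simp)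
    rw [this, map_zero]
  refine Module.Finite.of_injective ((LinearMap.range (P.map n f)).liftQ (P.map n g) h1) ?_
  rw [← LinearMap.ker_eq_bot]
  apply Submodule.ker_liftQ_eq_bot
  intro e he
  exact P.exact_mid hf hfg hg n e he

end MC

namespace Kos

variable {R : Type} [CommRing R] [IsNoetherianRing R] {t : ℕ} (x : Fin t → R)
variable {M : Type} [AddCommGroup M] [Module R M]

lemma tors_sup {I : Ideal R} {y : R} (h : Tors I M) (hy : ∀ m : M, y • m = 0) :
    Tors (I ⊔ Ideal.span {y}) M := by
  apply tors_of_local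
  intro m q hq hle
  by_cases hI : I ≤ q
  · refine ⟨y, fun hyq => hle (sup_le hI ((Ideal.span_singleton_le_iff_mem _).mpr hyq)), hy m⟩
  · exact h.exists_not_mem m q hI

lemma stepA [IsLocalRing R] (hx : idl x ≤ IsLocalRing.maximalIdeal R) (y : R)
    (hy : y ∈ IsLocalRing.maximalIdeal R)
    (hD : ∀ p q : Ideal R, p.IsPrime → q.IsPrime → idl x ≤ p → y ∈ p → p < q →
      q = IsLocalRing.maximalIdeal R)
    (ht : Tors (idl x) M) (h0 : (K x).FG 0 M) (h1 : (K x).FG 1 M) (h2 : (K x).FG 2 M) (n : ℕ) :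
    (LinearMap.ker (mu y ((K x).H n M))).FG ∧ CoF (mu y ((K x).H n M)) := by
  have i1 : Function.Injective (LinearMap.ker (mu y M)).subtype := Subtype.val_injective
  have i2 : Function.Injective (LinearMap.range (mu y M)).subtype := Subtype.val_injective
  have s1 := LinearMap.surjective_rangeRestrict (mu y M)
  have s2 := Submodule.mkQ_surjective (LinearMap.range (mu y M))
  have hle : idl x ⊔ Ideal.span {y} ≤ IsLocalRing.maximalIdeal R :=
    sup_le hx ((Ideal.span_singleton_le_iff_mem _).mpr hy)
  have hD' : ∀ p q : Ideal R, p.IsPrime → q.IsPrime → idl x ⊔ Ideal.span {y} ≤ p → p < q →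
      q = IsLocalRing.maximalIdeal R := fun p q hp hq hpl hlt =>
    hD p q hp hq (le_sup_left.trans hpl)
      (hpl (Ideal.mem_sup_right (Ideal.mem_span_singleton_self y))) hlt
  have n1 : (K x).FG 1 (LinearMap.ker (mu y M)) :=
    (K x).fg_left i1 (mu_exact1 y) s1 ((K x).fg_left_zero i2 h0) h1
  have ck : Cof x (LinearMap.ker (mu y M)) := by
    refine P1 x (idl x ⊔ Ideal.span {y}) le_sup_left hle hD' ?_ ((K x).fg_left_zero i1 h0) n1
    exact tors_sup (ht.of_inj _ i1) (fun m => Subtype.ext (mem_ker_mu.mp m.2))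
  have r1 : (K x).FG 1 (LinearMap.range (mu y M)) := (K x).fg_right i1 (mu_exact1 y) s1 h1 (ck 2)
  have r2 : (K x).FG 2 (LinearMap.range (mu y M)) := (K x).fg_right i1 (mu_exact1 y) s1 h2 (ck 3)
  have cq : Cof x (M ⧸ LinearMap.range (mu y M)) := by
    refine P1 x (idl x ⊔ Ideal.span {y}) le_sup_left hle hD' ?_
      ((K x).fg_right i2 (mu_exact2 y) s2 h0 r1) ((K x).fg_right i2 (mu_exact2 y) s2 h1 r2)
    refine tors_sup (ht.of_surj _ s2) (fun m => ?_)
    obtain ⟨m, rfl⟩ := s2 m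
    rw [← map_smul]
    exact (Submodule.Quotient.mk_eq_zero _).mpr ⟨m, rfl⟩
  have hcomp : mu y ((K x).H n M) = ((K x).map n (LinearMap.range (mu y M)).subtype) ∘ₗ
      ((K x).map n (mu y M).rangeRestrict) := by
    ext e
    rw [LinearMap.comp_apply, MC.map_comp]
    have : (LinearMap.range (mu y M)).subtype ∘ₗ (mu y M).rangeRestrict = mu y M := by
      ext; rfl
    rw [this, MC.map_smul_id]
    rfl
  rw [hcomp]
  constructor
  · apply fg_of_ker_comp
    · exact (K x).ker_map_g_fg i1 (mu_exact1 y) s1 n (ck n)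
    · cases n with
      | zero =>
        rw [(K x).ker_map_f_zero i2]
        exact Submodule.fg_bot
      | succ n => exact (K x).ker_map_f_fg i2 (mu_exact2 y) s2 n (cq n)
  · apply CoF.comp
    · exact (K x).coker_map_g i1 (mu_exact1 y) s1 (ck (n + 1))
    · exact (K x).coker_map_f i2 (mu_exact2 y) s2 (cq n)

lemma stepB [IsLocalRing R]
    (hD : ∀ p q r : Ideal R, p.IsPrime → q.IsPrime → r.IsPrime → idl x ≤ p → p < q → q < r →
      r = IsLocalRing.maximalIdeal R)
    (ht : Tors (idl x) M) (h0 : (K x).FG 0 M) (h1 : (K x).FG 1 M)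
    (q : Ideal R) [hq : q.IsPrime] (hxq : idl x ≤ q) (hne : q ≠ IsLocalRing.maximalIdeal R) (n : ℕ) :
    Module.Finite (Localization.AtPrime q) (Localization.AtPrime q ⊗[R] (K x).H n M) := by
  let C := Localization.AtPrime q
  have hspan : idl (mp C x) = (idl x).map (algebraMap R C) := span_mp x C
  have hc : Cof (mp C x) (C ⊗[R] M) := by
    refine P1 (mp C x) (idl (mp C x)) le_rfl ?_ ?_ ?_ (fg_bc x C h0) (fg_bc x C h1)
    · rw [hspan, ← IsLocalization.AtPrime.map_eq_maximalIdeal q C]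
      exact Ideal.map_mono hxq
    · intro P Q hP hQ hle hlt
      refine le_antisymm (IsLocalRing.le_maximalIdeal hQ.ne_top) (loc_max_le q Q ?_)
      by_contra hne'
      have e1 := loc_comap_le q Q hQ
      refine hne (hD (P.comap (algebraMap R C)) (Q.comap (algebraMap R C)) q
        (Ideal.comap_isPrime _ _) (Ideal.comap_isPrime _ _) hq ?_ ?_ (lt_of_le_of_ne e1 hne'))
      · rw [hspan] at hle; exact Ideal.map_le_iff_le_comap.mp hle
      · refine lt_of_le_of_ne (Ideal.comap_mono hlt.le) ?_
        intro h
        apply hlt.ne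
        have e2 := IsLocalization.map_under q.primeCompl C P
        have e3 := IsLocalization.map_under q.primeCompl C Q
        rw [← e2, ← e3]
        exact congrArg _ h
    · rw [hspan]; exact ht.bc C
  have : Module.Finite C ((K (mp C x)).H n (C ⊗[R] M)) := hc n
  exact Module.Finite.equiv (bcK x C n M).symm

end Kos

end



set_option linter.unusedSectionVars false
section

open TensorProduct

section adic

variable {R : Type} [CommRing R]

lemma mem_smul_pi (I : Ideal R) {n : ℕ} (v : Fin n → R) (h : ∀ i, v i ∈ (I • ⊤ : Submodule R R)) :
    v ∈ (I • ⊤ : Submodule R (Fin n → R)) := by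
  rw [← Finset.univ_sum_single v]
  refine Submodule.sum_mem _ fun i _ => ?_
  have : Pi.single i (v i) = LinearMap.single R (fun _ : Fin n => R) i (v i) := rfl
  rw [this]
  have h2 := Submodule.mem_map_of_mem (f := LinearMap.single R (fun _ : Fin n => R) i) (h i)
  rw [Submodule.map_smul''] at h2
  exact Submodule.smul_mono le_rfl le_top h2

lemma prec_pi (I : Ideal R) [IsPrecomplete I R] (n : ℕ) : IsPrecomplete I (Fin n → R) := by
  refine ⟨fun f hf => ?_⟩
  have h1 : ∀ i, ∃ L : R, ∀ k, f k i ≡ L [SMOD (I ^ k • ⊤ : Submodule R R)] := by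
    intro i
    refine IsPrecomplete.prec' (fun k => f k i) ?_
    intro a b hab
    have h2 := hf hab
    rw [SModEq.sub_mem] at h2 ⊢
    have h3 := Submodule.mem_map_of_mem (f := LinearMap.proj (R := R) (φ := fun _ : Fin n => R) i) h2
    rw [Submodule.map_smul''] at h3
    exact Submodule.smul_mono le_rfl le_top h3
  choose L hL using h1
  refine ⟨L, fun k => ?_⟩
  rw [SModEq.sub_mem]
  apply mem_smul_pi
  intro i
  have := hL i k
  rw [SModEq.sub_mem] at this
  exact this

/-- compatible sequences of `y`-division -/
def Tt (y : R) (G : Type) [AddCommGroup G] [Module R G] : Submodule R (ℕ → G) where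
  carrier := {g | g 0 = 0 ∧ ∀ k, y • g (k + 1) = g k}
  zero_mem' := by simp
  add_mem' := by
    rintro u v ⟨h1, h2⟩ ⟨h3, h4⟩
    refine ⟨by simp [h1, h3], fun k => by simp [h2, h4]⟩
  smul_mem' := by
    rintro c u ⟨h1, h2⟩
    refine ⟨by simp [h1], fun k => by simp [smul_comm y c, h2]⟩

variable {y : R} {G : Type} [AddCommGroup G] [Module R G]

lemma Tt.one (t : Tt y G) : y • t.1 1 = 0 := by
  rw [t.2.2 0, t.2.1]

lemma Tt.div (t : Tt y G) (h : t.1 1 = 0) : ∃ u : Tt y G, y • u = t := by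
  refine ⟨⟨fun k => t.1 (k + 1), h, fun k => t.2.2 (k + 1)⟩, Subtype.ext ?_⟩
  funext k
  exact t.2.2 k

lemma Tt.pow (t : Tt y G) (n k : ℕ) : y ^ n • t.1 (k + n) = t.1 k := by
  induction n with
  | zero => simp
  | succ n ih => rw [pow_succ, mul_smul, ← add_assoc, t.2.2, ih]

/-- evaluation at one -/
def Tt.ev (y : R) (G : Type) [AddCommGroup G] [Module R G] (k : ℕ) : Tt y G →ₗ[R] G :=
  LinearMap.proj k ∘ₗ (Tt y G).subtype

lemma pow_kill {I : Ideal R} {N : ℕ} (h : ∀ a ∈ I ^ N, ∀ g : G, y • g = 0 → a • g = 0) (k : ℕ) :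
    ∀ a ∈ I ^ (N * k), ∀ g : G, y ^ k • g = 0 → a • g = 0 := by
  induction k with
  | zero => intro a _ g hg; simp at hg; simp [hg]
  | succ k ih =>
    intro a ha g hg
    rw [mul_add, mul_one, pow_add] at ha
    refine Submodule.mul_induction_on ha ?_ ?_
    · intro b hb c hc
      rw [mul_comm, mul_smul]
      refine h c hc _ ?_
      rw [smul_comm]
      refine ih b hb _ ?_
      rw [smul_smul, ← pow_succ, hg]
    · intro u v hu hv
      rw [add_smul, hu, hv, add_zero]

lemma Tt.finite [IsNoetherianRing R] (I : Ideal R) [IsPrecomplete I R] (hy : y ∈ I)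
    (hf : (LinearMap.ker (mu y G)).FG) {N : ℕ}
    (h : ∀ a ∈ I ^ N, ∀ g : G, y • g = 0 → a • g = 0) : Module.Finite R (Tt y G) := by
  have hH : IsHausdorff I (Tt y G) := by
    refine ⟨fun t ht => Subtype.ext (funext fun k => ?_)⟩
    have h1 := ht (N * k)
    rw [SModEq.zero] at h1
    have h2 := Submodule.mem_map_of_mem (f := Tt.ev y G k) h1
    rw [Submodule.map_smul''] at h2
    change Tt.ev y G k t = 0
    refine Submodule.smul_induction_on (p := fun g => g = 0) h2 ?_ ?_
    · rintro a ha _ ⟨u, -, rfl⟩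
      refine pow_kill h k a ha _ ?_
      have := Tt.pow u k 0
      rw [zero_add, u.2.1] at this
      exact this
    · rintro u v rfl rfl; simp
  have hr : (LinearMap.range (Tt.ev y G 1)).FG := by
    refine Submodule.FG.of_le hf ?_
    rintro _ ⟨t, rfl⟩
    exact mem_ker_mu.mpr (Tt.one t)
  have : Module.Finite R (LinearMap.range (Tt.ev y G 1)) := Module.Finite.iff_fg.mpr hr
  obtain ⟨n, s, hs⟩ := Module.Finite.exists_fin (R := R) (M := LinearMap.range (Tt.ev y G 1))
  choose r hr using fun i => (s i).2
  have := prec_pi I n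
  have hsurj : Function.Surjective (Fintype.linearCombination R r) := by
    apply surjective_of_mkQ_comp_surjective (I := I)
    intro t
    obtain ⟨t, rfl⟩ := Submodule.mkQ_surjective _ t
    have h1 : (⟨Tt.ev y G 1 t, t, rfl⟩ : LinearMap.range (Tt.ev y G 1)) ∈
      Submodule.span R (Set.range s) := hs ▸ trivial
    obtain ⟨c, hc⟩ := (Submodule.mem_span_range_iff_exists_fun R).mp h1
    refine ⟨c, ?_⟩
    rw [LinearMap.comp_apply, ← sub_eq_zero, ← map_sub]
    refine (Submodule.Quotient.mk_eq_zero _).mpr ?_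
    have h2 := congrArg Subtype.val hc
    obtain ⟨u, hu⟩ := Tt.div (Fintype.linearCombination R r c - t) (by
      change Tt.ev y G 1 (Fintype.linearCombination R r c - t) = 0
      rw [map_sub, sub_eq_zero, Fintype.linearCombination_apply, map_sum]
      change _ = (⟨Tt.ev y G 1 t, t, rfl⟩ : LinearMap.range (Tt.ev y G 1)).1
      rw [← h2]
      simp [hr])
    rw [← hu]
    exact Submodule.smul_mem_smul hy trivial
  exact Module.Finite.of_surjective _ hsurj

end adic

end



set_option linter.unusedSectionVars false
section

open TensorProduct

section lemC

variable {R : Type} [CommRing R] [IsNoetherianRing R] [IsLocalRing R]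

/-- generic elements: `dim R/(I + y) ≤ 1` -/
def Gen (I : Ideal R) (y : R) : Prop := y ∈ IsLocalRing.maximalIdeal R ∧
  ∀ p q : Ideal R, p.IsPrime → q.IsPrime → I ≤ p → y ∈ p → p < q →
      q = IsLocalRing.maximalIdeal R

variable {I : Ideal R}

lemma gen_mem (hD : ∀ p q r : Ideal R, p.IsPrime → q.IsPrime → r.IsPrime → I ≤ p → p < q → q < r →
      r = IsLocalRing.maximalIdeal R) (q : Ideal R) (hqp : q.IsPrime)
    (hq : ∀ r : Ideal R, r.IsPrime → q < r → r = IsLocalRing.maximalIdeal R) :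
    ∃ y ∈ q, Gen I y := by
  classical
  have hfin : {p : Ideal R | p.IsPrime ∧ I ≤ p ∧ ∃ r : Ideal R, r.IsPrime ∧ p < r ∧
      r ≠ IsLocalRing.maximalIdeal R}.Finite := by
    refine (Ideal.finite_minimalPrimes_of_isNoetherianRing R I).subset ?_
    rintro p ⟨hp, hIp, r, hr, hpr, hne⟩
    refine ⟨⟨hp, hIp⟩, ?_⟩
    rintro p' ⟨hp', hIp'⟩ hle
    rcases lt_or_eq_of_le hle with h | h
    · exact absurd (hD p' p r hp' hp hr hIp' h hpr) hne
    · exact h.ge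
  have hav : ∃ y ∈ q, ∀ p ∈ hfin.toFinset, y ∉ p := by
    have h2 : ∀ p ∈ hfin.toFinset, p.IsPrime ∧ ¬ q ≤ p := by
      intro p hp
      obtain ⟨hp1, hp2, r, hr, hpr, hne⟩ := hfin.mem_toFinset.mp hp
      refine ⟨hp1, fun hle => ?_⟩
      rcases lt_or_eq_of_le hle with h | h
      · rw [hq p hp1 h] at hpr
        exact absurd (IsLocalRing.le_maximalIdeal hr.ne_top) (not_le_of_gt hpr)
      · exact hne (hq r hr (h ▸ hpr))
    rcases hfin.toFinset.eq_empty_or_nonempty with h | ⟨J, hJ⟩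
    · exact ⟨0, q.zero_mem, by simp [h]⟩
    · obtain ⟨y, hy, -, hy2⟩ := avoid hfin.toFinset h2 (h2 J hJ).2
      exact ⟨y, hy, hy2⟩
  obtain ⟨y, hy, hy2⟩ := hav
  refine ⟨y, hy, IsLocalRing.le_maximalIdeal hqp.ne_top hy, ?_⟩
  intro p r hp hr hIp hyp hpr
  by_contra hne
  exact hy2 p (hfin.mem_toFinset.mpr ⟨hp, hIp, r, hr, hpr, hne⟩) hyp

lemma fin_div_zero {G : Type} [AddCommGroup G] [Module R G] [Module.Finite R G] (y : R)
    (hy : y ∈ IsLocalRing.maximalIdeal R) (h : ∀ g : G, ∃ u, y • u = g) (g : G) : g = 0 := by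
  have := Submodule.eq_bot_of_le_smul_of_le_jacobson_bot (IsLocalRing.maximalIdeal R)
    (⊤ : Submodule R G) Module.Finite.fg_top (by
      intro g _
      obtain ⟨u, rfl⟩ := h g
      exact Submodule.smul_mem_smul hy trivial) (IsLocalRing.maximalIdeal_le_jacobson _)
  have h2 : g ∈ (⊤ : Submodule R G) := trivial
  rw [this] at h2
  exact h2

/-- Krull: if `m` is minimal over `q + (y)` then `dim R/q ≤ 1`. -/
lemma krull_one (q : Ideal R) [q.IsPrime] (y : R) (hy : y ∈ IsLocalRing.maximalIdeal R)
    (h : ∀ p : Ideal R, p.IsPrime → q ≤ p → y ∈ p → p = IsLocalRing.maximalIdeal R)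
    (r : Ideal R) (hr : r.IsPrime) (hqr : q < r) : r = IsLocalRing.maximalIdeal R := by
  by_contra hne
  set m := IsLocalRing.maximalIdeal R
  have hqm : q ≤ m := IsLocalRing.le_maximalIdeal (Ideal.IsPrime.ne_top ‹_›)
  have hrm : r < m := lt_of_le_of_ne (IsLocalRing.le_maximalIdeal hr.ne_top) hne
  have hm : m ∈ (q ⊔ Ideal.span {y}).minimalPrimes := by
    refine ⟨⟨inferInstance, sup_le hqm ((Ideal.span_singleton_le_iff_mem _).mpr hy)⟩, ?_⟩
    rintro p ⟨hp, hle⟩ _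
    exact (h p hp (le_sup_left.trans hle)
      (hle (Ideal.mem_sup_right (Ideal.mem_span_singleton_self y)))).ge
  have h1 := Ideal.map_height_le_one_of_mem_minimalPrimes hm
  have hcm : ∀ J : Ideal R, q ≤ J → (J.map (Ideal.Quotient.mk q)).comap (Ideal.Quotient.mk q) = J := by
    intro J hJ
    rw [Ideal.comap_map_of_surjective _ Ideal.Quotient.mk_surjective]
    rw [← RingHom.ker_eq_comap_bot, Ideal.mk_ker, sup_eq_left.mpr hJ]
  have lt1 : ∀ J J' : Ideal R, q ≤ J → J < J' → J.map (Ideal.Quotient.mk q) <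
      J'.map (Ideal.Quotient.mk q) := by
    intro J J' hJ hlt
    refine lt_of_le_of_ne (Ideal.map_mono hlt.le) fun he => hlt.ne ?_
    rw [← hcm J hJ, ← hcm J' (hJ.trans hlt.le), he]
  have p1 : (r.map (Ideal.Quotient.mk q)).IsPrime :=
    Ideal.map_isPrime_of_surjective Ideal.Quotient.mk_surjective (by rw [Ideal.mk_ker]; exact hqr.le)
  have p2 : (m.map (Ideal.Quotient.mk q)).IsPrime :=
    Ideal.map_isPrime_of_surjective Ideal.Quotient.mk_surjective (by rw [Ideal.mk_ker]; exact hqm)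
  have p0 : (q.map (Ideal.Quotient.mk q)).IsPrime :=
    Ideal.map_isPrime_of_surjective Ideal.Quotient.mk_surjective (by rw [Ideal.mk_ker])
  have a1 := Ideal.height_add_one_le_of_lt_of_isPrime (lt1 q r le_rfl hqr)
  have a2 := Ideal.height_add_one_le_of_lt_of_isPrime (lt1 r m hqr.le hrm)
  have h3 : (1 : ℕ∞) + 1 ≤ 1 :=
    calc (1 : ℕ∞) + 1 ≤ ((q.map (Ideal.Quotient.mk q)).height + 1) + 1 := by
          gcongr; exact le_add_self
      _ ≤ (r.map (Ideal.Quotient.mk q)).height + 1 := by gcongr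
      _ ≤ _ := a2
      _ ≤ 1 := h1
  exact absurd h3 (by decide)

lemma key_zero [IsAdicComplete (IsLocalRing.maximalIdeal R) R]
    {G : Type} [AddCommGroup G] [Module R G]
    (hD : ∀ p q r : Ideal R, p.IsPrime → q.IsPrime → r.IsPrime → I ≤ p → p < q → q < r →
      r = IsLocalRing.maximalIdeal R)
    (hT : Tors (IsLocalRing.maximalIdeal R) G)
    (hk : ∀ y, Gen I y → (LinearMap.ker (mu y G)).FG)
    (hs : ∀ y, Gen I y → ∀ g : G, ∃ u, y • u = g) (g : G) : g = 0 := by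
  set m := IsLocalRing.maximalIdeal R with hm
  have hN : ∀ y, Gen I y → ∃ N : ℕ, ∀ a ∈ m ^ N, ∀ g : G, y • g = 0 → a • g = 0 := by
    intro y hy
    have : Module.Finite R (LinearMap.ker (mu y G)) := Module.Finite.iff_fg.mpr (hk y hy)
    obtain ⟨N, h⟩ := (hT.of_inj (LinearMap.ker (mu y G)).subtype Subtype.val_injective).finite
    refine ⟨N, fun a ha g hg => ?_⟩
    exact congrArg Subtype.val (h a ha ⟨g, mem_ker_mu.mpr hg⟩)
  obtain ⟨y, -, hy⟩ := gen_mem hD m inferInstance (fun r hr hlt =>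
    absurd (IsLocalRing.le_maximalIdeal hr.ne_top) (not_le_of_gt hlt))
  obtain ⟨N, hN1⟩ := hN y hy
  have hfin : Module.Finite R (Tt y G) := Tt.finite m hy.1 (hk y hy) hN1
  by_contra hg
  -- a nonzero element killed by y
  obtain ⟨g', hg'0, hg'⟩ : ∃ g' : G, g' ≠ 0 ∧ y • g' = 0 := by
    obtain ⟨k, hk⟩ := hT g
    have hk2 : y ^ k • g = 0 := hk _ (Ideal.pow_mem_pow hy.1 k)
    by_contra! hcon
    have h : ∀ j, y ^ j • g ≠ 0 := by
      intro j
      induction j with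
      | zero => simpa using hg
      | succ j ih =>
        rw [pow_succ', mul_smul]
        exact hcon _ ih
    exact h k hk2
  choose dv hdv using hs y hy
  let sq : ℕ → G := fun k => Nat.rec 0 (fun k v => Nat.casesOn k g' (fun _ => dv v)) k
  have hsq : ∀ k, y • sq (k + 1) = sq k := by
    intro k
    cases k with
    | zero => exact hg'
    | succ k => exact hdv _
  let t : Tt y G := ⟨sq, rfl, hsq⟩
  have ht : t ≠ 0 := fun h => hg'0 (congrFun (congrArg Subtype.val h) 1)
  have : Nontrivial (Tt y G) := ⟨⟨t, 0, ht⟩⟩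
  obtain ⟨q, hq⟩ := associatedPrimes.nonempty R (Tt y G)
  obtain ⟨hqp, t0, hqt⟩ := (isAssociatedPrime_iff.mp hq)
  have hmem : ∀ a, a ∈ q ↔ a • t0 = 0 := by
    intro a
    rw [hqt, Submodule.mem_colon_singleton, Submodule.mem_bot]
  have ht0 : t0 ≠ 0 := by
    rintro rfl
    exact hqp.ne_top (Ideal.eq_top_of_isUnit_mem q ((hmem 1).mpr (by simp)) isUnit_one)
  have hmax : ∀ p : Ideal R, p.IsPrime → q ≤ p → y ∈ p → p = m := by
    intro p hp hqp' hyp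
    have h1 : (⟨p, hp⟩ : PrimeSpectrum R) ∈ Module.support R (Tt y G) := by
      rw [Module.mem_support_iff_exists_annihilator]
      refine ⟨t0, fun a ha => hqp' ((hmem a).mpr ?_)⟩
      exact (Submodule.mem_annihilator_span_singleton _ _).mp ha
    have h2 : (⟨p, hp⟩ : PrimeSpectrum R) ∈
        Module.support R (Tt y G ⧸ (Ideal.span {y} • ⊤ : Submodule R (Tt y G))) := by
      rw [Module.support_quotient]
      refine ⟨h1, ?_⟩
      rw [PrimeSpectrum.mem_zeroLocus]
      exact (Ideal.span_singleton_le_iff_mem _).mpr hyp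
    rw [Module.mem_support_iff_of_finite] at h2
    have h3 : m ^ N ≤ p := by
      refine le_trans ?_ h2
      intro a ha
      rw [Module.mem_annihilator]
      intro u
      obtain ⟨u, rfl⟩ := Submodule.mkQ_surjective _ u
      rw [← map_smul]
      refine (Submodule.Quotient.mk_eq_zero _).mpr ?_
      obtain ⟨v, hv⟩ := Tt.div (a • u) (hN1 a ha _ (Tt.one u))
      rw [← hv]
      exact Submodule.smul_mem_smul (Ideal.mem_span_singleton_self y) trivial
    exact le_antisymm (IsLocalRing.le_maximalIdeal hp.ne_top) (Ideal.IsPrime.le_of_pow_le h3)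
  obtain ⟨y', hy'q, hy'⟩ := gen_mem hD q hqp (krull_one q y hy.1 hmax)
  obtain ⟨N', hN'⟩ := hN y' hy'
  apply ht0
  refine Subtype.ext (funext fun k => ?_)
  rw [← Tt.pow t0 N' k]
  refine hN' _ (Ideal.pow_mem_pow hy.1 N') _ ?_
  have := congrArg Subtype.val ((hmem y').mp hy'q)
  exact congrFun this _

theorem lemC [IsAdicComplete (IsLocalRing.maximalIdeal R) R]
    {E : Type} [AddCommGroup E] [Module R E]
    (hD : ∀ p q r : Ideal R, p.IsPrime → q.IsPrime → r.IsPrime → I ≤ p → p < q → q < r →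
      r = IsLocalRing.maximalIdeal R)
    (hI : ∀ a ∈ I, ∀ e : E, a • e = 0)
    (hk : ∀ y, Gen I y → (LinearMap.ker (mu y E)).FG)
    (hs : ∀ y, Gen I y → CoF (mu y E))
    (hl : ∀ (q : Ideal R) [q.IsPrime], I ≤ q → q ≠ IsLocalRing.maximalIdeal R →
      Module.Finite (Localization.AtPrime q) (Localization.AtPrime q ⊗[R] E)) :
    Module.Finite R E := by
  set m := IsLocalRing.maximalIdeal R with hm
  obtain ⟨y, -, hy⟩ := gen_mem hD m inferInstance (fun r hr hlt =>
    absurd (IsLocalRing.le_maximalIdeal hr.ne_top) (not_le_of_gt hlt))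
  obtain ⟨F, hF, hFy⟩ := hs y hy
  have sF := Submodule.mkQ_surjective F
  have hyG : ∀ g : E ⧸ F, ∃ u, y • u = g := by
    intro g
    obtain ⟨e, rfl⟩ := sF g
    have : e ∈ F ⊔ LinearMap.range (mu y E) := hFy ▸ trivial
    obtain ⟨f, hf, _, ⟨u, rfl⟩, rfl⟩ := Submodule.mem_sup.mp this
    refine ⟨F.mkQ u, ?_⟩
    rw [map_add, ← map_smul]
    have : F.mkQ f = 0 := (Submodule.Quotient.mk_eq_zero _).mpr hf
    rw [this, zero_add]
    rfl
  have hsG : ∀ y', Gen I y' → ∀ g : E ⧸ F, ∃ u, y' • u = g := by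
    intro y' hy' g
    obtain ⟨F', hF', hFy'⟩ := hs y' hy'
    let r := LinearMap.range (mu y' (E ⧸ F))
    have hfin : Module.Finite R ((E ⧸ F) ⧸ r) := by
      have : Module.Finite R F' := Module.Finite.iff_fg.mpr hF'
      refine Module.Finite.of_surjective (r.mkQ ∘ₗ F.mkQ ∘ₗ F'.subtype) ?_
      intro c
      obtain ⟨c, rfl⟩ := Submodule.mkQ_surjective r c
      obtain ⟨e, rfl⟩ := sF c
      have : e ∈ F' ⊔ LinearMap.range (mu y' E) := hFy' ▸ trivial
      obtain ⟨f, hf, _, ⟨u, rfl⟩, rfl⟩ := Submodule.mem_sup.mp this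
      refine ⟨⟨f, hf⟩, ?_⟩
      simp only [LinearMap.comp_apply, Submodule.subtype_apply, map_add]
      rw [left_eq_add]
      exact (Submodule.Quotient.mk_eq_zero _).mpr ⟨F.mkQ u, rfl⟩
    have h0 := fin_div_zero (G := (E ⧸ F) ⧸ r) y hy.1 (by
      intro c
      obtain ⟨c, rfl⟩ := Submodule.mkQ_surjective r c
      obtain ⟨u, rfl⟩ := hyG c
      exact ⟨r.mkQ u, by rw [map_smul]⟩) (r.mkQ g)
    exact mem_range_mu.mp ((Submodule.Quotient.mk_eq_zero _).mp h0)
  have hkG : ∀ y', Gen I y' → (LinearMap.ker (mu y' (E ⧸ F))).FG := by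
    intro y' hy'
    have h1 : (F.comap (mu y' E)).FG := by
      apply Submodule.fg_of_fg_map_of_fg_inf_ker (mu y' E)
      · exact Submodule.FG.of_le hF (Submodule.map_comap_le _ _)
      · exact Submodule.FG.of_le (hk y' hy') inf_le_right
    refine Submodule.FG.of_le (h1.map F.mkQ) ?_
    intro g hg
    obtain ⟨e, rfl⟩ := sF g
    refine ⟨e, ?_, rfl⟩
    rw [mem_ker_mu, ← map_smul] at hg
    exact (Submodule.Quotient.mk_eq_zero F).mp hg
  have hT : Tors m (E ⧸ F) := by
    apply tors_of_local
    have hmain : ∀ (g : E ⧸ F) (q : Ideal R), q.IsPrime → I ≤ q → q ≠ m →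
        (∀ r : Ideal R, r.IsPrime → q < r → r = m) → ∃ s ∉ q, s • g = 0 := by
      intro g q hq hIq hne hmx
      apply loc_zero q
      obtain ⟨y', hy'q, hy'⟩ := gen_mem hD q hq hmx
      have := hl q hIq hne
      let C := Localization.AtPrime q
      have : Module.Finite C (C ⊗[R] (E ⧸ F)) :=
        Module.Finite.of_surjective (F.mkQ.baseChange C) (by
          exact LinearMap.lTensor_surjective C sF)
      have : IsNoetherianRing C := IsLocalization.isNoetherianRing q.primeCompl C inferInstance
      apply fin_div_zero (R := C) (algebraMap R C y')
      · rw [← IsLocalization.AtPrime.map_eq_maximalIdeal q C]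
        exact Ideal.mem_map_of_mem _ hy'q
      · intro c
        simp only [algebraMap_smul]
        induction c with
        | zero => exact ⟨0, smul_zero _⟩
        | add u v hu hv =>
          obtain ⟨a, rfl⟩ := hu
          obtain ⟨b, rfl⟩ := hv
          exact ⟨a + b, smul_add _ _ _⟩
        | tmul c g =>
          obtain ⟨u, rfl⟩ := hsG y' hy' g
          exact ⟨c ⊗ₜ u, by rw [tmul_smul]⟩
    intro g q hq hmq
    have hne : q ≠ m := fun h => hmq h.ge
    by_cases hIq : I ≤ q
    · by_cases hmx : ∀ r : Ideal R, r.IsPrime → q < r → r = m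
      · exact hmain g q hq hIq hne hmx
      · push Not at hmx
        obtain ⟨r, hr, hqr, hrne⟩ := hmx
        obtain ⟨s, hs, h⟩ := hmain g r hr (hIq.trans hqr.le) hrne
          (fun r' hr' hlt => hD q r r' hq hr hr' hIq hqr hlt)
        exact ⟨s, fun h => hs (hqr.le h), h⟩
    · obtain ⟨s, hs, hsq⟩ := SetLike.not_le_iff_exists.mp hIq
      refine ⟨s, hsq, ?_⟩
      obtain ⟨e, rfl⟩ := sF g
      rw [← map_smul, hI s hs, map_zero]
  have hz := key_zero hD hT hkG hsG
  have : F = ⊤ := by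
    rw [eq_top_iff]
    intro e _
    exact (Submodule.Quotient.mk_eq_zero _).mp (hz (F.mkQ e))
  exact ⟨this ▸ hF⟩

end lemC

namespace Kos

variable {R : Type} [CommRing R] [IsNoetherianRing R] {t : ℕ} (x : Fin t → R)
variable {M : Type} [AddCommGroup M] [Module R M]

theorem P2 [IsLocalRing R] [IsAdicComplete (IsLocalRing.maximalIdeal R) R]
    (hx : idl x ≤ IsLocalRing.maximalIdeal R)
    (hD : ∀ p q r : Ideal R, p.IsPrime → q.IsPrime → r.IsPrime → idl x ≤ p → p < q → q < r →
      r = IsLocalRing.maximalIdeal R)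
    (ht : Tors (idl x) M) (h0 : (K x).FG 0 M) (h1 : (K x).FG 1 M) (h2 : (K x).FG 2 M) :
    Cof x M := by
  intro n
  refine lemC (I := idl x) hD (fun a ha e => kill x n a ha e) ?_ ?_ ?_
  · intro y hy
    exact (stepA x hx y hy.1 hy.2 ht h0 h1 h2 n).1
  · intro y hy
    exact (stepA x hx y hy.1 hy.2 ht h0 h1 h2 n).2
  · intro q _ hq hne
    exact stepB x hD ht h0 h1 q hq hne n

end Kos

end



set_option linter.unusedSectionVars false
section

section completion

open IsLocalRing

variable (A : Type) [CommRing A] [IsNoetherianRing A] [IsLocalRing A]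

/-- the completion of a local ring -/
abbrev Ahat : Type := AdicCompletion (maximalIdeal A) A

variable {A}

lemma idealOfVars_map {n : ℕ} (a : Fin n → A) (ha : ∀ i, a i ∈ maximalIdeal A) (k : ℕ) :
    MvPolynomial.idealOfVars (Fin n) A ^ k ≤
      (maximalIdeal A ^ k).comap (MvPolynomial.aeval a : MvPolynomial (Fin n) A →ₐ[A] A).toRingHom := by
  rw [← Ideal.map_le_iff_le_comap, Ideal.map_pow]
  apply Ideal.pow_right_mono
  rw [MvPolynomial.idealOfVars, Ideal.map_span, Ideal.span_le]
  rintro _ ⟨_, ⟨i, rfl⟩, rfl⟩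
  simpa using ha i

/-- finite levels of the evaluation map -/
def evk {n : ℕ} (a : Fin n → A) (ha : ∀ i, a i ∈ maximalIdeal A) (k : ℕ) :
    MvPowerSeries (Fin n) A →+* A ⧸ maximalIdeal A ^ k :=
  (Ideal.quotientMap _ (MvPolynomial.aeval a : MvPolynomial (Fin n) A →ₐ[A] A).toRingHom
    (idealOfVars_map a ha k)).comp (MvPowerSeries.truncTotalAlgHom (Fin n) A k).toRingHom

lemma evk_coe {n : ℕ} (a : Fin n → A) (ha : ∀ i, a i ∈ maximalIdeal A) (k : ℕ)
    (p : MvPolynomial (Fin n) A) :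
    evk a ha k (algebraMap _ _ p) = Ideal.Quotient.mk _ (MvPolynomial.aeval a p) := by
  have : (MvPowerSeries.truncTotalAlgHom (Fin n) A k).toRingHom (algebraMap _ _ p) =
      Ideal.Quotient.mk _ p := (MvPowerSeries.truncTotalAlgHom (Fin n) A k).commutes p
  rw [evk, RingHom.comp_apply, this, Ideal.quotientMap_mk]
  rfl

lemma evk_compat {n : ℕ} (a : Fin n → A) (ha : ∀ i, a i ∈ maximalIdeal A) {k l : ℕ} (h : k ≤ l) :
    (Ideal.Quotient.factorPow (maximalIdeal A) h).comp (evk a ha l) = evk a ha k := by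
  have h1 : ∀ (j : ℕ) (p : MvPowerSeries (Fin n) A), evk a ha j p =
      Ideal.Quotient.mk _ (MvPolynomial.aeval a (MvPowerSeries.truncTotal j p)) := by
    intro j p
    rw [evk, RingHom.comp_apply]
    exact Ideal.quotientMap_mk
  ext p
  rw [RingHom.comp_apply, h1, h1]
  change Ideal.Quotient.mk _ _ = Ideal.Quotient.mk _ _
  rw [Ideal.Quotient.eq, ← map_sub]
  exact idealOfVars_map a ha k
    (MvPowerSeries.truncTotal_sub_truncTotal_mem_pow_idealOfVars h le_rfl p)

/-- evaluation of power series in the completion -/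
def evh {n : ℕ} (a : Fin n → A) (ha : ∀ i, a i ∈ maximalIdeal A) :
    MvPowerSeries (Fin n) A →+* Ahat A :=
  AdicCompletion.liftRingHom (maximalIdeal A) (evk a ha) (evk_compat a ha)

lemma evh_coe {n : ℕ} (a : Fin n → A) (ha : ∀ i, a i ∈ maximalIdeal A)
    (p : MvPolynomial (Fin n) A) :
    evh a ha (algebraMap _ _ p) = algebraMap A (Ahat A) (MvPolynomial.aeval a p) := by
  refine AdicCompletion.ext_evalₐ fun k => ?_
  rw [evh, AdicCompletion.evalₐ_liftRingHom, evk_coe]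
  exact ((AdicCompletion.evalₐ (maximalIdeal A) k).commutes _).symm

instance noeth_Ahat : IsNoetherianRing (Ahat A) := by
  obtain ⟨n, a, ha⟩ := Submodule.fg_iff_exists_fin_generating_family.mp
    (IsNoetherian.noetherian (maximalIdeal A))
  have ham : ∀ i, a i ∈ maximalIdeal A := fun i => ha ▸ Submodule.subset_span ⟨i, rfl⟩
  let J : Ideal (MvPowerSeries (Fin n) A) := Ideal.span (Set.range MvPowerSeries.X)
  have hX : ∀ i, evh a ham (MvPowerSeries.X i) = algebraMap A (Ahat A) (a i) := by
    intro i
    have := evh_coe a ham (MvPolynomial.X i)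
    rw [MvPolynomial.aeval_X] at this
    rw [← this]
    congr 1
    exact (MvPolynomial.coe_X i).symm
  have hJ : J.map (evh a ham) = maximalIdeal (Ahat A) := by
    have h2 : maximalIdeal A = Ideal.span (Set.range a) := ha.symm
    rw [AdicCompletion.maximalIdeal_eq_map,
      show Ideal.map (algebraMap A (Ahat A)) (maximalIdeal A) =
        Ideal.map (algebraMap A (Ahat A)) (Ideal.span (Set.range a)) from
        congrArg (Ideal.map (algebraMap A (Ahat A))) h2,
      Ideal.map_span, Ideal.map_span, ← Set.range_comp, ← Set.range_comp]
    congr 2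
    funext i
    exact hX i
  have hh : IsHausdorff (J.map (evh a ham)) (Ahat A) := by
    rw [hJ]; infer_instance
  have hs : Function.Surjective (evh a ham) := by
    apply surjective_of_mk_map_comp_surjective (I := J)
    intro c
    obtain ⟨c, rfl⟩ := Ideal.Quotient.mk_surjective c
    obtain ⟨r, hr⟩ := (AdicCompletion.residueField_map_bijective A).2 (residue _ c)
    obtain ⟨r, rfl⟩ := residue_surjective r
    rw [ResidueField.map_residue] at hr
    refine ⟨algebraMap (MvPolynomial (Fin n) A) _ (MvPolynomial.C r), ?_⟩
    rw [RingHom.comp_apply, evh_coe, Ideal.Quotient.eq, hJ, MvPolynomial.aeval_C]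
    exact Ideal.Quotient.eq.mp hr
  exact isNoetherianRing_of_surjective _ _ _ hs

instance flat_Ahat : Module.FaithfullyFlat A (Ahat A) := by
  have : Module.Flat A (Ahat A) := AdicCompletion.flat_of_isNoetherian (maximalIdeal A)
  exact Module.FaithfullyFlat.of_flat_of_isLocalHom

end completion

section dimension

open IsLocalRing

variable {R : Type} [CommRing R] [IsNoetherianRing R] [IsLocalRing R]

lemma chain3 (I p q r : Ideal R) (hp : p.IsPrime) (hq : q.IsPrime) (hr : r.IsPrime) (hI : I ≤ p)
    (hpq : p < q) (hqr : q < r) (hne : r ≠ maximalIdeal R) :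
    3 ≤ ((maximalIdeal R).map (Ideal.Quotient.mk I)).height := by
  set m := maximalIdeal R
  have hrm : r < m := lt_of_le_of_ne (le_maximalIdeal hr.ne_top) hne
  have hcm : ∀ J : Ideal R, I ≤ J → (J.map (Ideal.Quotient.mk I)).comap (Ideal.Quotient.mk I) = J := by
    intro J hJ
    rw [Ideal.comap_map_of_surjective _ Ideal.Quotient.mk_surjective]
    rw [← RingHom.ker_eq_comap_bot, Ideal.mk_ker, sup_eq_left.mpr hJ]
  have lt1 : ∀ J J' : Ideal R, I ≤ J → J < J' → J.map (Ideal.Quotient.mk I) <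
      J'.map (Ideal.Quotient.mk I) := by
    intro J J' hJ hlt
    refine lt_of_le_of_ne (Ideal.map_mono hlt.le) fun he => hlt.ne ?_
    rw [← hcm J hJ, ← hcm J' (hJ.trans hlt.le), he]
  have pr : ∀ J : Ideal R, J.IsPrime → I ≤ J → (J.map (Ideal.Quotient.mk I)).IsPrime :=
    fun J hJ hIJ => Ideal.map_isPrime_of_surjective Ideal.Quotient.mk_surjective
      (by rw [Ideal.mk_ker]; exact hIJ)
  have hIq := hI.trans hpq.le
  have hIr := hIq.trans hqr.le
  have p0 := pr p hp hI
  have p1 := pr q hq hIq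
  have p2 := pr r hr hIr
  have p3 := pr m inferInstance (hIr.trans hrm.le)
  have a0 := Ideal.height_add_one_le_of_lt_of_isPrime (lt1 p q hI hpq)
  have a1 := Ideal.height_add_one_le_of_lt_of_isPrime (lt1 q r hIq hqr)
  have a2 := Ideal.height_add_one_le_of_lt_of_isPrime (lt1 r m hIr hrm)
  calc (3 : ℕ∞) = 0 + 1 + 1 + 1 := by norm_num
    _ ≤ ((p.map (Ideal.Quotient.mk I)).height + 1) + 1 + 1 := by gcongr; exact bot_le
    _ ≤ (q.map (Ideal.Quotient.mk I)).height + 1 + 1 := by gcongr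
    _ ≤ (r.map (Ideal.Quotient.mk I)).height + 1 := by gcongr
    _ ≤ _ := a2

/-- `dim R/I ≤ 2` in terms of chains of primes -/
def DD (I : Ideal R) : Prop := ∀ p q r : Ideal R, p.IsPrime → q.IsPrime → r.IsPrime → I ≤ p →
  p < q → q < r → r = maximalIdeal R

lemma DD_of_dim {I : Ideal R} (h : ringKrullDim (R ⧸ I) = 2) : DD I := by
  intro p q r hp hq hr hI hpq hqr
  by_contra hne
  have h3 := chain3 I p q r hp hq hr hI hpq hqr hne
  have hpm : ((maximalIdeal R).map (Ideal.Quotient.mk I)).IsPrime :=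
    Ideal.map_isPrime_of_surjective Ideal.Quotient.mk_surjective
      (by rw [Ideal.mk_ker]; exact hI.trans (le_maximalIdeal hp.ne_top))
  have h4 := Ideal.height_le_ringKrullDim_of_ne_top hpm.ne_top
  rw [h] at h4
  have h5 : ((maximalIdeal R).map (Ideal.Quotient.mk I)).height ≤ 2 := WithBot.coe_le_coe.mp h4
  exact absurd (h3.trans h5) (by decide)

lemma sop {I : Ideal R} (hD : DD I) : ∃ y ∈ maximalIdeal R, ∃ z ∈ maximalIdeal R,
    ∀ p : Ideal R, p.IsPrime → I ≤ p → y ∈ p → z ∈ p → p = maximalIdeal R := by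
  classical
  obtain ⟨y, -, hy⟩ := gen_mem hD (maximalIdeal R) inferInstance (fun r hr hlt =>
    absurd (IsLocalRing.le_maximalIdeal hr.ne_top) (not_le_of_gt hlt))
  have hfin : {p : Ideal R | p.IsPrime ∧ I ⊔ Ideal.span {y} ≤ p ∧ p ≠ maximalIdeal R}.Finite := by
    refine (Ideal.finite_minimalPrimes_of_isNoetherianRing R (I ⊔ Ideal.span {y})).subset ?_
    rintro p ⟨hp, hIp, hne⟩
    refine ⟨⟨hp, hIp⟩, ?_⟩
    rintro p' ⟨hp', hIp'⟩ hle
    rcases lt_or_eq_of_le hle with h | h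
    · exact absurd (hy.2 p' p hp' hp (le_sup_left.trans hIp')
        (hIp' (Ideal.mem_sup_right (Ideal.mem_span_singleton_self y))) h) hne
    · exact h.ge
  have h2 : ∀ p ∈ hfin.toFinset, p.IsPrime ∧ ¬ maximalIdeal R ≤ p := by
    intro p hp
    obtain ⟨hp1, hp2, hne⟩ := hfin.mem_toFinset.mp hp
    exact ⟨hp1, fun hle => hne (le_antisymm (le_maximalIdeal hp1.ne_top) hle)⟩
  obtain ⟨z, hz, hz2⟩ : ∃ z ∈ maximalIdeal R, ∀ p ∈ hfin.toFinset, z ∉ p := by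
    rcases hfin.toFinset.eq_empty_or_nonempty with h | ⟨J, hJ⟩
    · exact ⟨0, zero_mem _, fun p hp => by rw [h] at hp; exact absurd hp (Finset.notMem_empty p)⟩
    · obtain ⟨y, hy, -, hy2⟩ := avoid hfin.toFinset h2 (h2 J hJ).2
      exact ⟨y, hy, hy2⟩
  refine ⟨y, hy.1, z, hz, ?_⟩
  intro p hp hIp hyp hzp
  by_contra hne
  exact hz2 p (hfin.mem_toFinset.mpr
    ⟨hp, sup_le hIp ((Ideal.span_singleton_le_iff_mem _).mpr hyp), hne⟩) hzp

lemma DD_of_sop {I : Ideal R} (y z : R) (hy : y ∈ maximalIdeal R) (hz : z ∈ maximalIdeal R)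
    (h : ∀ p : Ideal R, p.IsPrime → I ≤ p → y ∈ p → z ∈ p → p = maximalIdeal R) : DD I := by
  intro p q r hp hq hr hI hpq hqr
  by_contra hne
  have h3 := chain3 p p q r hp hq hr le_rfl hpq hqr hne
  have hpm : p ≤ maximalIdeal R := le_maximalIdeal hp.ne_top
  let f := Ideal.Quotient.mk p
  have hmin : (maximalIdeal R).map f ∈ (Ideal.span {f y, f z}).minimalPrimes := by
    refine ⟨⟨Ideal.map_isPrime_of_surjective Ideal.Quotient.mk_surjective
      (by rw [Ideal.mk_ker]; exact hpm), ?_⟩, ?_⟩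
    · rw [Ideal.span_le]
      rintro _ (rfl | rfl)
      · exact Ideal.mem_map_of_mem f hy
      · exact Ideal.mem_map_of_mem f hz
    · rintro P ⟨hP, hle⟩ _
      have e := h (P.comap f) (Ideal.comap_isPrime f P) (hI.trans ?_)
        (hle (Ideal.subset_span (by simp))) (hle (Ideal.subset_span (by simp)))
      · rw [Ideal.map_le_iff_le_comap]
        exact e.ge
      · intro a ha
        rw [Ideal.mem_comap, Ideal.Quotient.eq_zero_iff_mem.mpr ha]
        exact P.zero_mem
  have h4 := Ideal.height_le_card_of_mem_minimalPrimes_span (Set.toFinite _) hmin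
  have h5 : (({f y, f z} : Set (R ⧸ p)).ncard : ℕ∞) ≤ 2 := by
    exact_mod_cast Set.ncard_insert_le _ _ |>.trans (by simp)
  exact absurd (h3.trans (h4.trans h5)) (by decide)

lemma DD_hat {I : Ideal R} (hD : DD I) : DD (I.map (algebraMap R (Ahat R))) := by
  obtain ⟨y, hy, z, hz, h⟩ := sop hD
  have hmm : maximalIdeal (Ahat R) = (maximalIdeal R).map (algebraMap R (Ahat R)) :=
    AdicCompletion.maximalIdeal_eq_map
  refine DD_of_sop (algebraMap R (Ahat R) y) (algebraMap R (Ahat R) z) ?_ ?_ ?_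
  · rw [hmm]; exact Ideal.mem_map_of_mem _ hy
  · rw [hmm]; exact Ideal.mem_map_of_mem _ hz
  · intro P hP hIP hyP hzP
    have e := h (P.comap (algebraMap R (Ahat R))) (Ideal.comap_isPrime _ P)
      (Ideal.map_le_iff_le_comap.mp hIP) hyP hzP
    refine le_antisymm (le_maximalIdeal hP.ne_top) ?_
    rw [hmm, Ideal.map_le_iff_le_comap]
    exact e.ge

end dimension

namespace Kos

open IsLocalRing TensorProduct

variable {R : Type} [CommRing R] [IsNoetherianRing R] [IsLocalRing R] {t : ℕ} (x : Fin t → R)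
variable {M : Type} [AddCommGroup M] [Module R M]

theorem P3 (hx : idl x ≤ maximalIdeal R) (hD : DD (idl x))
    (ht : Tors (idl x) M) (h0 : (K x).FG 0 M) (h1 : (K x).FG 1 M) (h2 : (K x).FG 2 M) :
    Cof x M := by
  let C := Ahat R
  have hspan : idl (mp C x) = (idl x).map (algebraMap R C) := span_mp x C
  have hc : Cof (mp C x) (C ⊗[R] M) := by
    refine P2 (mp C x) ?_ ?_ ?_ (fg_bc x C h0) (fg_bc x C h1) (fg_bc x C h2)
    · rw [hspan]
      exact (Ideal.map_mono hx).trans (AdicCompletion.maximalIdeal_eq_map (R := R)).ge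
    · rw [hspan]; exact DD_hat hD
    · rw [hspan]; exact ht.bc C
  intro n
  exact fg_of_bc x C (hc n)

end Kos

end



section
set_option linter.unusedSectionVars false

namespace Res
variable {R : Type} [CommRing R] [IsNoetherianRing R]

/-- a matrix -/
structure St (R : Type) where
  m : ℕ
  n : ℕ
  D : Fin m → Fin n → R

/-- the map of row vectors given by a matrix -/
def bd {ι κ : Type} [Fintype ι] [Fintype κ] (D : κ → ι → R) : (κ → R) →ₗ[R] (ι → R) :=
  Fintype.linearCombination R D

lemma bd_apply {ι κ : Type} [Fintype ι] [Fintype κ] (D : κ → ι → R) (v : κ → R) (i : ι) :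
    bd D v i = ∑ k, v k * D k i := by
  simp [bd, Fintype.linearCombination_apply]

lemma bd_single {ι κ : Type} [Fintype ι] [Fintype κ] [DecidableEq κ] (D : κ → ι → R) (k : κ) :
    bd D (Pi.single k 1) = D k := by
  simp [bd, Fintype.linearCombination_apply_single]

lemma exists_next (S : St R) : ∃ (k : ℕ) (D : Fin k → Fin S.m → R),
    LinearMap.range (bd D) = LinearMap.ker (bd S.D) := by
  obtain ⟨k, D, h⟩ := Submodule.fg_iff_exists_fin_generating_family.mp
    (IsNoetherian.noetherian (LinearMap.ker (bd S.D)))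
  exact ⟨k, D, by rw [bd, Fintype.range_linearCombination, h]⟩

/-- next syzygy matrix -/
def next (S : St R) : St R := ⟨(exists_next S).choose, S.m, (exists_next S).choose_spec.choose⟩

lemma next_spec (S : St R) : LinearMap.range (bd (next S).D) = LinearMap.ker (bd S.D) :=
  (exists_next S).choose_spec.choose_spec

/-- sequence of syzygies -/
def sq {t : ℕ} (x : Fin t → R) : ℕ → St R
  | 0 => ⟨t, 1, fun j _ => x j⟩
  | n + 1 => next (sq x n)

/-- index types -/
def ix {t : ℕ} (x : Fin t → R) : ℕ → Type
  | 0 => Fin 0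
  | n + 1 => Fin (sq x n).n

instance {t : ℕ} (x : Fin t → R) : ∀ n, Fintype (ix x n)
  | 0 => inferInstanceAs (Fintype (Fin 0))
  | n + 1 => inferInstanceAs (Fintype (Fin (sq x n).n))

/-- matrices -/
def Dm {t : ℕ} (x : Fin t → R) : ∀ n, ix x (n + 1) → ix x n → R
  | 0 => fun _ i => i.elim0
  | n + 1 => (sq x n).D

lemma exact {t : ℕ} (x : Fin t → R) (n : ℕ) :
    LinearMap.range (bd (Dm x (n + 2))) = LinearMap.ker (bd (Dm x (n + 1))) :=
  next_spec (sq x n)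

/-- the resolution -/
def Q {t : ℕ} (x : Fin t → R) : MC R where
  ι := ix x
  fin := inferInstance
  D := Dm x
  dd n k i := by
    classical
    cases n with
    | zero => exact i.elim0
    | succ n =>
      have h : Dm x (n + 2) k ∈ LinearMap.ker (bd (Dm x (n + 1))) := by
        rw [← exact]
        exact ⟨Pi.single k 1, bd_single _ _⟩
      have := congrFun (LinearMap.mem_ker.mp h) i
      rw [bd_apply] at this
      exact this

variable {t : ℕ} (x : Fin t → R)
instance : IsEmpty ((Q x).ι 0) := inferInstanceAs (IsEmpty (Fin 0))
instance : Nonempty ((Q x).ι 1) := inferInstanceAs (Nonempty (Fin 1))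
instance : Subsingleton ((Q x).ι 1) := inferInstanceAs (Subsingleton (Fin 1))

/-- boundary -/
def b (n : ℕ) : ((Q x).ι (n + 1) → R) →ₗ[R] ((Q x).ι n → R) := bd ((Q x).D n)

lemma b_exact (n : ℕ) : LinearMap.range (b x (n + 2)) = LinearMap.ker (b x (n + 1)) := exact x n

lemma b_b (n : ℕ) (v) : b x n (b x (n + 1) v) = 0 := by
  ext i
  simp only [b, bd_apply, Finset.sum_mul, mul_assoc, Pi.zero_apply]
  rw [Finset.sum_comm]
  simp only [← Finset.mul_sum, (Q x).dd, mul_zero, Finset.sum_const_zero]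

lemma range_b_one (v : (Q x).ι 1 → R) :
    v ∈ LinearMap.range (b x 1) ↔ ∀ i, v i ∈ Ideal.span (Set.range x) := by
  constructor
  · rintro ⟨w, rfl⟩ i
    rw [b, bd_apply]
    exact Ideal.sum_mem _ fun k _ => Ideal.mul_mem_left _ _ (Ideal.subset_span ⟨k, rfl⟩)
  · intro h
    obtain ⟨c, hc⟩ := (Submodule.mem_span_range_iff_exists_fun R).mp (h (0 : Fin 1))
    refine ⟨c, ?_⟩
    ext i
    obtain rfl : i = (0 : Fin 1) := Subsingleton.elim _ _
    exact (bd_apply (D := (Q x).D 1) c (0 : Fin 1)).trans hc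

lemma homotopy (a : R) (ha : a ∈ Ideal.span (Set.range x)) (n : ℕ) :
    ∃ (s : ((Q x).ι (n + 1) → R) →ₗ[R] ((Q x).ι (n + 2) → R))
      (s' : ((Q x).ι n → R) →ₗ[R] ((Q x).ι (n + 1) → R)),
      ∀ v, b x (n + 1) (s v) + s' (b x n v) = a • v := by
  classical
  have lift : ∀ n (f : ((Q x).ι (n + 1) → R) →ₗ[R] ((Q x).ι (n + 1) → R)),
      (∀ v, f v ∈ LinearMap.range (b x (n + 1))) →
      ∃ s : ((Q x).ι (n + 1) → R) →ₗ[R] ((Q x).ι (n + 2) → R), ∀ v, b x (n + 1) (s v) = f v := by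
    intro n f hf
    obtain ⟨s, hs⟩ := Module.projective_lifting_property (b x (n + 1)).rangeRestrict
      (f.codRestrict _ hf) (LinearMap.surjective_rangeRestrict _)
    exact ⟨s, fun v => congrArg Subtype.val (LinearMap.congr_fun hs v)⟩
  induction n with
  | zero =>
    obtain ⟨s, hs⟩ := lift 0 (a • LinearMap.id) (fun v => by
      rw [range_b_one]
      intro i
      exact Ideal.mul_mem_right _ _ ha)
    exact ⟨s, 0, fun v => by rw [hs]; simp⟩
  | succ n ih =>
    obtain ⟨s, s', h⟩ := ih
    obtain ⟨s1, hs1⟩ := lift (n + 1) (a • LinearMap.id - s ∘ₗ b x (n + 1)) (fun v => by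
      rw [b_exact, LinearMap.mem_ker]
      have := h (b x (n + 1) v)
      rw [b_b, map_zero, add_zero] at this
      simp [this])
    exact ⟨s1, s, fun v => by rw [hs1]; simp⟩

variable {M : Type} [AddCommGroup M] [Module R M]

lemma pair_b (n : ℕ) (z : (Q x).ι n → M) (v) :
    Fintype.linearCombination R z (b x n v) = Fintype.linearCombination R ((Q x).d n M z) v := by
  simp only [Fintype.linearCombination_apply, b, bd_apply, MC.d_apply, Finset.sum_smul,
    Finset.smul_sum, mul_smul]
  rw [Finset.sum_comm]

lemma kill (n : ℕ) (a : R) (ha : a ∈ Ideal.span (Set.range x)) (c : (Q x).H n M) :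
    a • c = 0 := by
  classical
  obtain ⟨z, rfl⟩ := (Q x).cls_surj n c
  obtain ⟨s, s', h⟩ := homotopy x a ha n
  rw [← map_smul, MC.cls_eq_zero]
  refine ⟨fun k => Fintype.linearCombination R z.1 (s' (Pi.single k 1)), ?_⟩
  have key : ∀ v, Fintype.linearCombination R
      (fun k => Fintype.linearCombination R z.1 (s' (Pi.single k 1))) v =
      Fintype.linearCombination R z.1 (s' v) := by
    intro v
    have : Fintype.linearCombination R
      (fun k => Fintype.linearCombination R z.1 (s' (Pi.single k 1))) =
      Fintype.linearCombination R z.1 ∘ₗ s' := by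
      ext k
      simp [Fintype.linearCombination_apply_single]
    rw [this]; rfl
  ext i
  have h1 := congrArg (Fintype.linearCombination R z.1) (h (Pi.single i 1))
  rw [map_add, pair_b, LinearMap.mem_ker.mp z.2, ← key, pair_b] at h1
  simp only [map_smul, Fintype.linearCombination_apply_single, one_smul] at h1
  rw [show (a • z : LinearMap.ker ((Q x).d (n + 1) M)).1 i = a • z.1 i from rfl, ← h1]
  simp [Fintype.linearCombination_apply]

/-- Transfer of finiteness. -/
lemma finite_iff_of (S : ShortComplex (ModuleCat.{0} R)) (P : MC R) (n : ℕ)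
    (e : S.X₂ ≃ₗ[R] (P.ι (n + 1) → M))
    (hg : ∀ z : S.X₂, S.g z = 0 ↔ P.d (n + 1) M (e z) = 0)
    (hf : ∀ z : S.X₂, (∃ w, S.f w = z) ↔ ∃ w, P.d n M w = e z) :
    Module.Finite R S.homology ↔ P.FG n M := by
  let e1 : LinearMap.ker S.g.hom ≃ₗ[R] LinearMap.ker (P.d (n + 1) M) :=
    e.ofSubmodules _ _ (by
      ext w
      constructor
      · rintro ⟨z, hz, rfl⟩
        exact (hg z).mp hz
      · intro hw
        exact ⟨e.symm w, (hg _).mpr (by simpa using hw), by simp⟩)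
  have e2 : (LinearMap.ker S.g.hom ⧸ LinearMap.range S.moduleCatToCycles) ≃ₗ[R] P.H n M :=
    Submodule.Quotient.equiv _ _ e1 (by
      ext w
      constructor
      · rintro ⟨z, ⟨y, rfl⟩, rfl⟩
        exact (hf _).mp ⟨y, rfl⟩
      · intro hw
        obtain ⟨z, rfl⟩ := e1.surjective w
        obtain ⟨y, hy⟩ := (hf z.1).mpr hw
        exact ⟨z, ⟨y, Subtype.ext hy⟩, rfl⟩)
  exact ⟨fun _ => Module.Finite.equiv (S.moduleCatHomologyIso.toLinearEquiv.trans e2),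
    fun (_ : Module.Finite R (P.H n M)) =>
      Module.Finite.equiv (S.moduleCatHomologyIso.toLinearEquiv.trans e2).symm⟩

/-- The resolution as a chain complex. -/
def cx : ChainComplex (ModuleCat.{0} R) ℕ :=
  ChainComplex.of (fun n => ModuleCat.of R ((Q x).ι (n + 1) → R))
    (fun n => ModuleCat.ofHom (b x (n + 1))) (fun n => by
      rw [← ModuleCat.ofHom_comp]
      exact congrArg ModuleCat.ofHom (LinearMap.ext fun v => b_b x (n + 1) v))

end Res

end



section
set_option linter.unusedSectionVars false

namespace Res
variable {R : Type} [CommRing R] [IsNoetherianRing R] {t : ℕ} (x : Fin t → R)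

lemma cx_d (n : ℕ) : (cx x).d (n + 1) n = ModuleCat.ofHom (b x (n + 1)) :=
  
  ChainComplex.of_d (fun n => ModuleCat.of R ((Q x).ι (n + 1) → R))
    (fun n => ModuleCat.ofHom (b x (n + 1))) n

lemma cx_d_apply (n : ℕ) (v : (Q x).ι (n + 2) → R) :
    ((cx x).d (n + 1) n).hom v = b x (n + 1) v := by
  rw [cx_d]; rfl

/-- augmentation -/
def aug : ((Q x).ι 1 → R) →ₗ[R] (R ⧸ Ideal.span (Set.range x)) :=
  (Ideal.span (Set.range x)).mkQ ∘ₗ LinearMap.proj (0 : Fin 1)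

lemma aug_eq_zero (v) : aug x v = 0 ↔ v ∈ LinearMap.range (b x 1) := by
  rw [range_b_one]
  constructor
  · intro h i
    obtain rfl : i = (0 : Fin 1) := Subsingleton.elim _ _
    exact (Submodule.Quotient.mk_eq_zero _).mp h
  · intro h
    exact (Submodule.Quotient.mk_eq_zero _).mpr (h (0 : Fin 1))

lemma aug_surj : Function.Surjective (aug x) := by
  intro c
  obtain ⟨a, rfl⟩ := Submodule.mkQ_surjective _ c
  exact ⟨fun _ => a, rfl⟩

/-- augmentation as a morphism -/
def augm : (cx x).X 0 ⟶ ModuleCat.of R (R ⧸ Ideal.span (Set.range x)) :=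
  ModuleCat.ofHom (aug x)

lemma d_augm : (cx x).d 1 0 ≫ augm x = 0 := by
  ext v
  have h : aug x (b x 1 v) = 0 := (aug_eq_zero x _).mpr ⟨v, rfl⟩
  have h2 := cx_d_apply x 0 v
  exact (congrArg (aug x) h2).trans h

/-- augmentation as a chain map -/
def pi : cx x ⟶ (ChainComplex.single₀ (ModuleCat.{0} R)).obj
    (ModuleCat.of R (R ⧸ Ideal.span (Set.range x))) :=
  ((cx x).toSingle₀Equiv _).symm ⟨augm x, d_augm x⟩

lemma pi_f_zero : (pi x).f 0 = augm x := ChainComplex.toSingle₀Equiv_symm_apply_f_zero _ _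

lemma exactAt (n : ℕ) : (cx x).ExactAt (n + 1) := by
  rw [HomologicalComplex.exactAt_iff' _ (n + 2) (n + 1) n (by simp) (by simp)]
  rw [ShortComplex.moduleCat_exact_iff]
  intro v hv
  have hv' : b x (n + 1) v = 0 := (cx_d_apply x n v).symm.trans hv
  have : v ∈ LinearMap.range (b x (n + 2)) := by
    rw [b_exact]; exact hv'
  obtain ⟨w, hw⟩ := this
  exact ⟨w, (cx_d_apply x (n + 1) w).trans hw⟩

lemma quasi : QuasiIso (pi x) where
  quasiIsoAt n := by
    cases n with
    | zero =>
      rw [ChainComplex.quasiIsoAt₀_iff, ShortComplex.quasiIso_iff_of_zeros' _ rfl rfl rfl]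
      constructor
      · rw [ShortComplex.moduleCat_exact_iff]
        intro v hv
        have hv' : aug x v = 0 := by
          have h1 : ((pi x).f 0).hom v = 0 := hv
          rw [pi_f_zero] at h1
          exact h1
        obtain ⟨w, hw⟩ := (aug_eq_zero x v).mp hv'
        exact ⟨w, (cx_d_apply x 0 w).trans hw⟩
      · have : Epi ((pi x).f 0) := by
          rw [pi_f_zero]
          exact (ModuleCat.epi_iff_surjective (augm x)).mpr (aug_surj x)
        exact this
    | succ m =>
      rw [quasiIsoAt_iff_exactAt' (hL := ChainComplex.exactAt_succ_single_obj ..)]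
      exact exactAt x m

/-- projective resolution -/
def resn : ProjectiveResolution (ModuleCat.of R (R ⧸ Ideal.span (Set.range x))) where
  complex := cx x
  projective n := by
    have : Projective (ModuleCat.of R ((Q x).ι (n + 1) → R)) :=
      ModuleCat.projective_of_categoryTheory_projective _
    exact this
  π := pi x
  quasiIso := quasi x

variable {M : Type} [AddCommGroup M] [Module R M]

/-- homs out of a free module -/
def homEq (n : ℕ) : ((cx x).X n ⟶ ModuleCat.of R M) ≃ₗ[R] ((Q x).ι (n + 1) → M) := by
  classical
  exact (ModuleCat.homLinearEquiv (S := R)).trans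
    ((Pi.basisFun R ((Q x).ι (n + 1))).constr R).symm

lemma homEq_apply (n : ℕ) [DecidableEq ((Q x).ι (n + 1))] (f : (cx x).X n ⟶ ModuleCat.of R M) (i) :
    homEq x n f i = f.hom (Pi.single i 1 : (Q x).ι (n + 1) → R) := by
  have : homEq x n f i = f.hom (Pi.basisFun R ((Q x).ι (n + 1)) i) := rfl
  rw [this]
  congr 1
  exact Pi.basisFun_apply R ((Q x).ι (n + 1)) i

lemma homEq_d (n : ℕ) (f : (cx x).X n ⟶ ModuleCat.of R M) :
    homEq x (n + 1) ((cx x).d (n + 1) n ≫ f) = (Q x).d (n + 1) M (homEq x n f) := by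
  classical
  ext i
  rw [homEq_apply, MC.d_apply]
  have h1 : ((cx x).d (n + 1) n ≫ f).hom (Pi.single i 1 : (Q x).ι (n + 2) → R) =
      f.hom (b x (n + 1) (Pi.single i 1)) := congrArg f.hom (cx_d_apply x n _)
  rw [h1, b, bd_single]
  have h2 : (Q x).D (n + 1) i = ∑ k, (Q x).D (n + 1) i k • (Pi.single k 1 : (Q x).ι (n + 1) → R) := by
    ext k
    simp [Finset.sum_apply, Pi.single_apply]
  have h3 := congrArg f.hom h2
  rw [h3]
  refine (map_sum f.hom _ _).trans (Finset.sum_congr rfl fun k _ => ?_)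
  rw [homEq_apply]
  exact map_smul f.hom _ _

lemma finite_homology (n : ℕ) :
    Module.Finite R (((cx x).linearYonedaObj R (ModuleCat.of R M)).homology n) ↔ (Q x).FG n M := by
  let C := (cx x).linearYonedaObj R (ModuleCat.of R M)
  have hn : (ComplexShape.up ℕ).next n = n + 1 := by simp
  have hd : ∀ n (f : C.X n), homEq (M := M) x (n + 1) ((C.d n (n + 1)).hom f) =
      (Q x).d (n + 1) M (homEq x n f) := fun n f => homEq_d x n f
  cases n with
  | zero =>
    have e : C.homology 0 ≅ (C.sc' 0 0 1).homology :=
      ShortComplex.homologyMapIso (C.isoSc' 0 0 1 (by simp) (by simp))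
    have h0 : ∀ w : C.X 0, (C.d 0 0).hom w = 0 := fun w => by
      rw [C.shape 0 0 (by simp)]; rfl
    have := finite_iff_of (M := M) (C.sc' 0 0 1) (Q x) 0 (homEq x 0)
      (fun z => by
        exact ((homEq (M := M) x 1).map_eq_zero_iff).symm.trans
          (iff_of_eq (congrArg (· = 0) (hd 0 z))))
      (fun z => by
        constructor
        · rintro ⟨w, rfl⟩
          refine ⟨0, ?_⟩
          have : (C.sc' 0 0 1).f.hom w = 0 := h0 w
          refine (map_zero _).trans ?_
          refine Eq.trans ?_ (congrArg (homEq (M := M) x 0) this).symm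
          exact (map_zero _).symm
        · rintro ⟨w, hw⟩
          obtain rfl : w = 0 := Subsingleton.elim _ _
          rw [map_zero] at hw
          have : z = 0 := (homEq (M := M) x 0).map_eq_zero_iff.mp hw.symm
          exact ⟨0, (map_zero (C.sc' 0 0 1).f.hom).trans this.symm⟩)
    rw [← this]
    exact Module.Finite.equiv_iff e.toLinearEquiv
  | succ n =>
    have e : C.homology (n + 1) ≅ (C.sc' n (n + 1) (n + 2)).homology :=
      ShortComplex.homologyMapIso (C.isoSc' n (n + 1) (n + 2) (by simp) (by simp))
    have := finite_iff_of (M := M) (C.sc' n (n + 1) (n + 2)) (Q x) (n + 1) (homEq x (n + 1))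
      (fun z => by
        exact ((homEq (M := M) x (n + 2)).map_eq_zero_iff).symm.trans
          (iff_of_eq (congrArg (· = 0) (hd (n + 1) z))))
      (fun z => by
        constructor
        · rintro ⟨w, rfl⟩
          exact ⟨homEq x n w, (hd n w).symm⟩
        · rintro ⟨w, hw⟩
          obtain ⟨v, rfl⟩ := (homEq (M := M) x n).surjective w
          exact ⟨v, (homEq (M := M) x (n + 1)).injective ((hd n v).trans hw)⟩)
    rw [← this]
    exact Module.Finite.equiv_iff e.toLinearEquiv

lemma ext_finite_iff (n : ℕ) :
    Module.Finite R (extQuot (Ideal.span (Set.range x)) M n) ↔ (Q x).FG n M := by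
  rw [← finite_homology]
  exact Module.Finite.equiv_iff ((resn x).isoExt n (ModuleCat.of R M)).toLinearEquiv

lemma cof_iff : (∀ n, (Q x).FG n M) ↔ ∀ n, (Kos.K x).FG n M := by
  constructor
  · intro h n
    refine MC.compare (Kos.K x) (Q x) h ?_ n
    intro n j i e
    exact Kos.kill x n _ (Ideal.subset_span ⟨j, rfl⟩) e
  · intro h n
    refine MC.compare (Q x) (Kos.K x) h ?_ n
    intro n j i e
    refine kill x n _ ?_ e
    refine Ideal.sum_mem _ fun k _ => ?_
    split_ifs
    · exact Ideal.mul_mem_left _ _ (Ideal.subset_span ⟨k, rfl⟩)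
    · exact zero_mem _

end Res

end


/-- If `A` is local, `𝔞 = (x₁, …, x_t)`, `dim A/𝔞 = 2`, and `Supp M ⊆ V(𝔞)`, then `M` is
`𝔞`-cofinite iff `H^i(x,M)` is finitely generated for all `i ≤ 2`. -/
theorem stmt11 [IsNoetherianRing A] [IsLocalRing A] (𝔞 : Ideal A) {t : ℕ} (x : Fin t → A)
    (hgen : 𝔞 = Ideal.span (Set.range x))
    (hdim : ringKrullDim (A ⧸ 𝔞) = 2)
    (M : Type) [AddCommGroup M] [Module A M]
    (hsupp : Module.support A M ⊆ PrimeSpectrum.zeroLocus (𝔞 : Set A)) :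
    IsCofinite 𝔞 M ↔ (∀ i ≤ 2, Module.Finite A (KoszulCohomology x M i)) := by
  subst hgen
  have hx : Ideal.span (Set.range x) ≤ IsLocalRing.maximalIdeal A := by
    refine IsLocalRing.le_maximalIdeal fun h => ?_
    have : Subsingleton (A ⧸ Ideal.span (Set.range x)) := Ideal.Quotient.subsingleton_iff.mpr h
    rw [ringKrullDim_eq_bot_of_subsingleton] at hdim
    exact absurd hdim (by decide)
  have ht : Tors (Ideal.span (Set.range x)) M := by
    refine tors_of_local fun m q hq hIq => ?_
    by_contra hcon
    push Not at hcon
    refine hIq (hsupp (a := ⟨q, hq⟩) (Module.mem_support_iff_exists_annihilator.mpr ⟨m, ?_⟩))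
    intro s hs
    by_contra hsq
    exact hcon s hsq ((Submodule.mem_annihilator_span_singleton m s).mp hs)
  constructor
  · rintro ⟨-, h⟩ i -
    exact (Kos.koszul_finite_iff x i).mpr
      ((Res.cof_iff x).mp (fun n => (Res.ext_finite_iff x n).mp (h n)) i)
  · intro h
    have hc : Kos.Cof x M := Kos.P3 x hx (DD_of_dim hdim) ht
      ((Kos.koszul_finite_iff x 0).mp (h 0 (by norm_num)))
      ((Kos.koszul_finite_iff x 1).mp (h 1 (by norm_num)))
      ((Kos.koszul_finite_iff x 2).mp (h 2 (by norm_num)))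
    exact ⟨hsupp, fun n => (Res.ext_finite_iff x n).mpr ((Res.cof_iff x).mpr hc n)⟩

end
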